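/- Let C ≥ 1, λ > 0, Λ > 0, let p : (0,1]×ℝ^d×ℝ^d → [0,∞) be measurable with p(t,x,y) ≤ C·(Γ_λ(t; x−y) + η(t; x−y)) for all t ∈ (0,1] and x,y ∈ ℝ^d, let μ be a nonnegative Borel measure on ℝ^d, let G : ℝ^d×ℝ^d → [0,∞) be bounded measurable, and let c : ℝ^d×ℝ^d → [0,Λ] be measurable. Define q⁽⁰⁾ := p and, for k ≥ 1, q⁽ᵏ⁾(t,x,y) := ∫₀^t ∫_{ℝ^d} p(t−s,x,z)·q⁽ᵏ⁻¹⁾(s,z,y) μ(dz) ds + ∫₀^t ∫_{ℝ^d×ℝ^d} p(t−s,x,z)·q⁽ᵏ⁻¹⁾(s,w,y)·c(z,w)·G(z,w)/|z−w|^{d+α} dz dw ds. Then there exist constants C' ≥ 1 and M ≥ 1, depending only on d, α, C, λ, Λ, such that for every k ≥ 0 and every (t,x,y) ∈ (0,1]×ℝ^d×ℝ^d, q⁽ᵏ⁾(t,x,y) ≤ C'·p_{2λ/3}(t,x,y)·( (M·N(t))^k + k·‖G‖_∞·M·(M·N(t))^{k−1} ), where N(t) := N_μ^{α,λ/3}(t)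 + N_G^{α,λ/3}(t), ‖G‖_∞ is the supremum norm of G, and for k = 0 the second summand is interpreted as 0. -/

import Mathlib

open MeasureTheory Set ENNReal

noncomputable def Gam (d : ℕ) (lam t : ℝ) (x : EuclideanSpace ℝ (Fin d)) : ℝ :=
  t ^ (-(d : ℝ) / 2) * Real.exp (-lam * ‖x‖ ^ 2 / t)

noncomputable def eta (d : ℕ) (α t : ℝ) (x : EuclideanSpace ℝ (Fin d)) : ℝ :=
  t / (t ^ ((1 : ℝ) / 2) + ‖x‖) ^ ((d : ℝ) + α)

noncomputable def pc (d : ℕ) (α c t : ℝ) (x y : EuclideanSpace ℝ (Fin d)) : ℝ :=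
  Gam d c t (x - y) + eta d α t (x - y)

noncomputable def Nmu (d : ℕ) (α lam : ℝ) (μ : Measure (EuclideanSpace ℝ (Fin d)))
    (t : ℝ) : ℝ≥0∞ :=
  ⨆ x : EuclideanSpace ℝ (Fin d), ∫⁻ s in Set.Ioc (0 : ℝ) t, ∫⁻ y,
    ENNReal.ofReal (Gam d lam s (x - y) + eta d α s (x - y)) ∂μ

noncomputable def NF (d : ℕ) (α lam : ℝ)
    (G : EuclideanSpace ℝ (Fin d) → EuclideanSpace ℝ (Fin d) → ℝ) (t : ℝ) : ℝ≥0∞ :=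
  ⨆ y : EuclideanSpace ℝ (Fin d), ∫⁻ s in Set.Ioc (0 : ℝ) t,
    ∫⁻ zw : EuclideanSpace ℝ (Fin d) × EuclideanSpace ℝ (Fin d),
      ENNReal.ofReal ((Gam d lam s (y - zw.1) + eta d α s (y - zw.1)) *
        (G zw.1 zw.2 + G zw.2 zw.1) / ‖zw.1 - zw.2‖ ^ ((d : ℝ) + α))


noncomputable def gg (D c t u : ℝ) : ℝ := t ^ (-D / 2) * Real.exp (-c * u ^ 2 / t)
noncomputable def ee (n t u : ℝ) : ℝ := t / (√t + u) ^ n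

lemma gg_nonneg (D c : ℝ) {t : ℝ} (u : ℝ) (ht : 0 < t) : 0 ≤ gg D c t u := by
  unfold gg; positivity

lemma ee_nonneg (n : ℝ) {t u : ℝ} (ht : 0 < t) (hu : 0 ≤ u) : 0 ≤ ee n t u := by
  unfold ee; positivity

lemma one_add_rpow_le_exp (n c : ℝ) (hc : 0 < c) :
    ∃ K : ℝ, 1 ≤ K ∧ ∀ y : ℝ, 0 ≤ y → (1 + y) ^ n ≤ K * Real.exp (c * y) := by
  obtain ⟨m, hm⟩ := exists_nat_ge n
  refine ⟨max 1 (m.factorial * Real.exp c / c ^ m), le_max_left _ _, fun y hy => ?_⟩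
  have h1 : (1 + y) ^ n ≤ (1 + y) ^ m := by
    rw [← Real.rpow_natCast]
    exact Real.rpow_le_rpow_of_exponent_le (by linarith) hm
  have h2 := Real.pow_div_factorial_le_exp (c * (1 + y)) (by positivity) m
  rw [div_le_iff₀ (by positivity), mul_pow] at h2
  have h3 : Real.exp (c * (1 + y)) = Real.exp c * Real.exp (c * y) := by
    rw [← Real.exp_add]; ring_nf
  rw [h3] at h2
  calc (1 + y) ^ n ≤ (1 + y) ^ m := h1
    _ ≤ (m.factorial * Real.exp c / c ^ m) * Real.exp (c * y) := by
      rw [div_mul_eq_mul_div, le_div_iff₀ (by positivity)]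
      linarith
    _ ≤ _ := by gcongr; exact le_max_right _ _

lemma ee_comp {n r t u x κ : ℝ} (hn : 0 ≤ n) (hr : 0 < r) (hrt : r ≤ t) (hu : 0 ≤ u) (hx : 0 ≤ x)
    (hκ : 0 ≤ κ) (h : √t + x ≤ κ * (√r + u)) : ee n r u ≤ κ ^ n * ee n t x := by
  unfold ee
  have ht : 0 < t := by linarith
  have hA : 0 < √r + u := by positivity
  have hB : 0 < √t + x := by positivity
  have h1 : (√t + x) ^ n ≤ κ ^ n * (√r + u) ^ n := by
    rw [← Real.mul_rpow hκ hA.le]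
    exact Real.rpow_le_rpow hB.le h hn
  rw [← mul_div_assoc, div_le_div_iff₀ (by positivity) (by positivity)]
  have : 0 ≤ κ ^ n * (√r + u) ^ n := by positivity
  calc r * (√t + x) ^ n ≤ t * (κ ^ n * (√r + u) ^ n) := by gcongr
    _ = _ := by ring

lemma ee_comp' {n r t u x κ : ℝ} (hn : 0 ≤ n) (hr : 0 < r) (hrt : r ≤ t) (hu : 0 ≤ u) (hx : 0 ≤ x)
    (hκ : 0 ≤ κ) (htx : t ≤ x ^ 2) (h : x ≤ κ * u) : ee n r u ≤ (2 * κ) ^ n * ee n t x := by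
  refine ee_comp hn hr hrt hu hx (by positivity) ?_
  have h1 : √t ≤ x := Real.sqrt_le_iff.2 ⟨hx, htx⟩
  have h2 : 0 ≤ √r := Real.sqrt_nonneg r
  nlinarith [mul_nonneg hκ h2]

lemma ee_le {D α t u : ℝ} (hD : 0 ≤ D) (hα : 0 < α) (hα2 : α < 2) (ht : 0 < t) (ht1 : t ≤ 1)
    (hu : 0 ≤ u) : ee (D + α) t u ≤ t ^ (-D / 2) := by
  unfold ee
  have h1 : (√t) ^ (D + α) ≤ (√t + u) ^ (D + α) :=
    Real.rpow_le_rpow (by positivity) (by linarith) (by linarith)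
  have h2 : (√t) ^ (D + α) = t ^ ((D + α) / 2) := by
    rw [Real.sqrt_eq_rpow, ← Real.rpow_mul ht.le]; ring_nf
  calc t / (√t + u) ^ (D + α) ≤ t / t ^ ((D + α) / 2) := by
        rw [← h2]; gcongr
    _ = t ^ (1 - α / 2) * t ^ (-D / 2) := by
        rw [← Real.rpow_add ht]
        nth_rewrite 1 [← Real.rpow_one t]
        rw [← Real.rpow_sub ht]; ring_nf
    _ ≤ 1 * t ^ (-D / 2) := by
        gcongr
        exact Real.rpow_le_one ht.le ht1 (by linarith)
    _ = _ := one_mul _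

lemma rp_comp {D κ s t : ℝ} (hD : 0 ≤ D) (hκ : 0 < κ) (hs : 0 < s) (ht : 0 < t) (h : t ≤ κ * s) :
    s ^ (-D / 2) ≤ κ ^ (D / 2) * t ^ (-D / 2) := by
  have h1 : (κ * s) ^ (-D / 2) ≤ t ^ (-D / 2) :=
    Real.rpow_le_rpow_of_nonpos ht h (by linarith)
  rw [Real.mul_rpow hκ.le hs.le] at h1
  have h2 : κ ^ (D / 2) * κ ^ (-D / 2) = 1 := by
    rw [← Real.rpow_add hκ]; ring_nf; simp
  calc s ^ (-D / 2) = κ ^ (D / 2) * (κ ^ (-D / 2) * s ^ (-D / 2)) := by rw [← mul_assoc, h2, one_mul]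
    _ ≤ _ := by gcongr

lemma gg_mono {D c c' t u : ℝ} (ht : 0 < t) (h : c ≤ c') : gg D c' t u ≤ gg D c t u := by
  unfold gg; gcongr

lemma gg_split (D c b t u : ℝ) :
    gg D (c + b) t u = gg D c t u * Real.exp (-b * u ^ 2 / t) := by
  unfold gg; rw [mul_assoc, ← Real.exp_add]; ring_nf

lemma gg_le {D c t u : ℝ} (hc : 0 ≤ c) (ht : 0 < t) : gg D c t u ≤ t ^ (-D / 2) := by
  unfold gg
  have : Real.exp (-c * u ^ 2 / t) ≤ 1 := by
    rw [Real.exp_le_one_iff, neg_mul, neg_div]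
    have : 0 ≤ c * u ^ 2 / t := by positivity
    linarith
  exact mul_le_of_le_one_right (by positivity) this

/-- comparison of Gaussians from prefactor and exponent comparison -/
lemma gg_comp {D c c' κ b s t v x : ℝ} (hD : 0 ≤ D) (hκ : 0 < κ) (hs : 0 < s) (ht : 0 < t)
    (h : t ≤ κ * s) (he : c' * x ^ 2 / t ≤ c * v ^ 2 / s + b) :
    gg D c s v ≤ κ ^ (D / 2) * Real.exp b * gg D c' t x := by
  unfold gg
  have h1 := rp_comp hD hκ hs ht h
  have h2 : Real.exp (-c * v ^ 2 / s) ≤ Real.exp b * Real.exp (-c' * x ^ 2 / t) := by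
    rw [← Real.exp_add, Real.exp_le_exp]
    have e1 : -c * v ^ 2 / s = -(c * v ^ 2 / s) := by ring
    have e2 : -c' * x ^ 2 / t = -(c' * x ^ 2 / t) := by ring
    rw [e1, e2]; linarith
  calc _ ≤ (κ ^ (D / 2) * t ^ (-D / 2)) * (Real.exp b * Real.exp (-c' * x ^ 2 / t)) := by gcongr
    _ = _ := by ring

lemma cauchy2 {a b u v : ℝ} (ha : 0 < a) (hb : 0 < b) :
    (u + v) ^ 2 / (a + b) ≤ u ^ 2 / a + v ^ 2 / b := by
  rw [div_add_div _ _ ha.ne' hb.ne', div_le_div_iff₀ (by positivity) (by positivity)]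
  nlinarith [sq_nonneg (u * b - v * a)]

lemma gg_gg {D c : ℝ} (hD : 0 ≤ D) (hc : 0 < c) :
    ∃ K : ℝ, 1 ≤ K ∧ ∀ r s u v : ℝ, 0 < r → 0 < s → 0 ≤ u → 0 ≤ v →
      gg D (3 * c) r u * gg D (2 * c) s v ≤
        K * gg D (2 * c) (r + s) (u + v) * (gg D c r u + gg D c s v) := by
  refine ⟨4 ^ (D / 2), Real.one_le_rpow (by norm_num) (by positivity), ?_⟩
  intro r s u v hr hs hu hv
  set t := r + s with ht
  have htp : 0 < t := by positivity
  have hK := gg_nonneg D (2 * c) (u + v) htp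
  have h1 := gg_nonneg D c u hr
  have h2 := gg_nonneg D c v hs
  rcases le_or_gt t (4 * s) with h | h
  · have key : gg D (3 * c) r u * gg D (2 * c) s v ≤
        4 ^ (D / 2) * gg D (2 * c) t (u + v) * gg D c r u := by
      unfold gg
      have hp := rp_comp hD (by norm_num : (0 : ℝ) < 4) hs htp h
      have hE : Real.exp (-(3 * c) * u ^ 2 / r) * Real.exp (-(2 * c) * v ^ 2 / s) ≤
          Real.exp (-(2 * c) * (u + v) ^ 2 / t) * Real.exp (-c * u ^ 2 / r) := by
        rw [← Real.exp_add, ← Real.exp_add, Real.exp_le_exp]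
        have := mul_le_mul_of_nonneg_left (cauchy2 (u := u) (v := v) hr hs) (by positivity : 0 ≤ 2 * c)
        rw [← ht] at this
        have e1 : -(3 * c) * u ^ 2 / r + -(2 * c) * v ^ 2 / s
          = -(2 * c * (u ^ 2 / r + v ^ 2 / s)) + -c * u ^ 2 / r := by ring
        have e2 : -(2 * c) * (u + v) ^ 2 / t = -(2 * c * ((u + v) ^ 2 / t)) := by ring
        rw [e1, e2]; linarith
      calc _ = r ^ (-D / 2) * s ^ (-D / 2) * (Real.exp (-(3 * c) * u ^ 2 / r) * Real.exp (-(2 * c) * v ^ 2 / s)) := by ring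
        _ ≤ r ^ (-D / 2) * (4 ^ (D / 2) * t ^ (-D / 2)) * (Real.exp (-(2 * c) * (u + v) ^ 2 / t) * Real.exp (-c * u ^ 2 / r)) := by gcongr
        _ = _ := by ring
    refine key.trans ?_
    gcongr; linarith
  · have key : gg D (3 * c) r u * gg D (2 * c) s v ≤
        4 ^ (D / 2) * gg D (2 * c) t (u + v) * gg D c s v := by
      unfold gg
      have hp := rp_comp hD (by norm_num : (0 : ℝ) < 4) hr htp (by linarith)
      have hE : Real.exp (-(3 * c) * u ^ 2 / r) * Real.exp (-(2 * c) * v ^ 2 / s) ≤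
          Real.exp (-(2 * c) * (u + v) ^ 2 / t) * Real.exp (-c * v ^ 2 / s) := by
        rw [← Real.exp_add, ← Real.exp_add, Real.exp_le_exp]
        have h3 := cauchy2 (u := u) (v := v) (by positivity : 0 < r / 3) hs
        have h4 : (u + v) ^ 2 / (t / 2) ≤ (u + v) ^ 2 / (r / 3 + s) := by
          gcongr; linarith
        have := mul_le_mul_of_nonneg_left (h4.trans h3) hc.le
        have e1 : -(3 * c) * u ^ 2 / r + -(2 * c) * v ^ 2 / s
          = -(c * (u ^ 2 / (r / 3) + v ^ 2 / s)) + -c * v ^ 2 / s := by field_simp; ring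
        have e2 : -(2 * c) * (u + v) ^ 2 / t = -(c * ((u + v) ^ 2 / (t / 2))) := by field_simp
        rw [e1, e2]; linarith
      calc _ = r ^ (-D / 2) * s ^ (-D / 2) * (Real.exp (-(3 * c) * u ^ 2 / r) * Real.exp (-(2 * c) * v ^ 2 / s)) := by ring
        _ ≤ (4 ^ (D / 2) * t ^ (-D / 2)) * s ^ (-D / 2) * (Real.exp (-(2 * c) * (u + v) ^ 2 / t) * Real.exp (-c * v ^ 2 / s)) := by gcongr
        _ = _ := by ring
    refine key.trans ?_
    gcongr; linarith


lemma fin_aux {X K1 K A1 A B1 B : ℝ} (h : X ≤ K1 * A1 * B1) (hK1 : 0 ≤ K1) (hK : K1 ≤ K)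
    (hA1 : 0 ≤ A1) (hA : A1 ≤ A) (hB1 : 0 ≤ B1) (hB : B1 ≤ B) : X ≤ K * A * B := by
  refine h.trans ?_
  have hK0 : 0 ≤ K := hK1.trans hK
  have : 0 ≤ K * A := mul_nonneg hK0 (hA1.trans hA)
  gcongr

lemma exK5 (a b c d e : ℝ) : ∃ K : ℝ, 1 ≤ K ∧ a ≤ K ∧ b ≤ K ∧ c ≤ K ∧ d ≤ K ∧ e ≤ K :=
  ⟨1 + |a| + |b| + |c| + |d| + |e|, by
    have := le_abs_self a; have := le_abs_self b; have := le_abs_self c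
    have := le_abs_self d; have := le_abs_self e
    have := abs_nonneg a; have := abs_nonneg b; have := abs_nonneg c
    have := abs_nonneg d; have := abs_nonneg e
    refine ⟨?_, ?_, ?_, ?_, ?_, ?_⟩ <;> linarith⟩

lemma sqrt_aux {r t κ : ℝ} (hr : 0 ≤ r) (hκ : 0 ≤ κ) (h : t ≤ κ ^ 2 * r) : √t ≤ κ * √r := by
  rw [Real.sqrt_le_iff]
  refine ⟨by positivity, ?_⟩
  rw [mul_pow, Real.sq_sqrt hr]; exact h

set_option maxHeartbeats 1000000 in
lemma ee_gg {D α c : ℝ} (hD : 0 ≤ D) (hα : 0 < α) (hα2 : α < 2) (hc : 0 < c) :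
    ∃ K : ℝ, 1 ≤ K ∧ ∀ r s u v : ℝ, 0 < r → 0 < s → r + s ≤ 1 → 0 ≤ u → 0 ≤ v →
      ee (D + α) r u * gg D (2 * c) s v ≤
        K * (gg D (2 * c) (r + s) (u + v) + ee (D + α) (r + s) (u + v)) *
          ((gg D c r u + ee (D + α) r u) + (gg D c s v + ee (D + α) s v)) := by
  obtain ⟨K2, hK2, hexp⟩ := one_add_rpow_le_exp (D + α) (c / 4) (by positivity)
  set n := D + α with hn
  have hn0 : 0 ≤ n := by positivity
  have p1 : (0:ℝ) < 2 ^ n := by positivity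
  have p2 : (0:ℝ) < 4 ^ (D / 2) := by positivity
  have p3 : (0:ℝ) < 8 ^ (D / 2) * Real.exp (2 * c) := by positivity
  have p4 : (0:ℝ) < (2 * 2) ^ n := by positivity
  have p5 : (0:ℝ) < 32 ^ n * K2 := by positivity
  obtain ⟨K, hK, k1, k2, k3, k4, k5⟩ := exK5 (2 ^ n) (4 ^ (D / 2)) (8 ^ (D / 2) * Real.exp (2 * c))
    ((2 * 2) ^ n) (32 ^ n * K2)
  refine ⟨K, hK, ?_⟩
  intro r s u v hr hs hrs hu hv
  set t := r + s with ht
  set x := u + v with hx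
  have htp : 0 < t := by positivity
  have hx0 : 0 ≤ x := by positivity
  have q1 := gg_nonneg D (2 * c) x htp
  have q2 := ee_nonneg n htp hx0
  have q3 := gg_nonneg D c u hr
  have q4 := ee_nonneg n hr hu
  have q5 := gg_nonneg D c v hs
  have q6 := ee_nonneg n hs hv
  have q7 := gg_nonneg D (2 * c) v hs
  have m1 : gg D (2 * c) s v ≤ gg D c s v := gg_mono hs (by linarith)
  rcases lt_or_ge s (t / 8) with h8 | h8
  · rcases le_or_gt (x / 2) u with hux | hux
    · have e1 : ee n r u ≤ 2 ^ n * ee n t x := by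
        refine ee_comp hn0 hr (by linarith) hu hx0 (by norm_num) ?_
        have := sqrt_aux (r := r) (t := t) (κ := 2) hr.le (by norm_num) (by linarith)
        linarith
      refine fin_aux (K1 := 2 ^ n) (A1 := ee n t x) (B1 := gg D c s v) ?_ p1.le k1 q2
        (by linarith) q5 (by linarith)
      gcongr
    · have hvx : x / 2 ≤ v := by linarith
      have e1 : ee n r u ≤ 4 ^ (D / 2) * t ^ (-D / 2) :=
        (ee_le hD hα hα2 hr (by linarith) hu).trans (rp_comp hD (by norm_num) hr htp (by linarith))
      have e2 : gg D (2 * c) s v ≤ gg D c s v * Real.exp (-(2 * c) * x ^ 2 / t) := by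
        have : 2 * c = c + c := by ring
        rw [this, gg_split, ← this]
        refine mul_le_mul_of_nonneg_left (Real.exp_le_exp.2 ?_) q5
        have h3 : x ^ 2 / t * 2 ≤ v ^ 2 / s := by
          rw [div_mul_eq_mul_div, div_le_div_iff₀ htp hs]
          have : (x / 2) ^ 2 ≤ v ^ 2 := by gcongr
          nlinarith [sq_nonneg x]
        have := mul_le_mul_of_nonneg_left h3 hc.le
        have e1 : -c * v ^ 2 / s = - (c * (v ^ 2 / s)) := by ring
        have e2 : -(2 * c) * x ^ 2 / t = - (c * (x ^ 2 / t * 2)) := by ring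
        rw [e1, e2]; linarith
      refine fin_aux (K1 := 4 ^ (D / 2)) (A1 := gg D (2 * c) t x) (B1 := gg D c s v) ?_ p2.le
        k2 q1 (by linarith) q5 (by linarith)
      calc ee n r u * gg D (2 * c) s v
          ≤ (4 ^ (D / 2) * t ^ (-D / 2)) * (gg D c s v * Real.exp (-(2 * c) * x ^ 2 / t)) := by gcongr
        _ = _ := by unfold gg; ring
  · rcases le_or_gt (x ^ 2 / t - 1) (v ^ 2 / s) with hA | hB
    · have e1 : gg D (2 * c) s v ≤ 8 ^ (D / 2) * Real.exp (2 * c) * gg D (2 * c) t x := by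
        refine gg_comp hD (by norm_num) hs htp (by linarith) ?_
        have := mul_le_mul_of_nonneg_left hA (by positivity : 0 ≤ 2 * c)
        rw [mul_div_assoc, mul_div_assoc]; linarith
      refine fin_aux (K1 := 8 ^ (D / 2) * Real.exp (2 * c)) (A1 := gg D (2 * c) t x) (B1 := ee n r u) ?_
        p3.le k3 q1 (by linarith) q4 (by linarith)
      calc _ ≤ ee n r u * (8 ^ (D / 2) * Real.exp (2 * c) * gg D (2 * c) t x) := by gcongr
        _ = _ := by ring
    · have hv2 : 0 ≤ v ^ 2 / s := by positivity
      have hL : 1 < x ^ 2 / t := by linarith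
      have htx : t ≤ x ^ 2 := by
        rw [lt_div_iff₀ htp] at hL; linarith
      have hxpos : 0 < x := by
        rcases hx0.eq_or_lt with h | h
        · rw [← h] at htx; nlinarith
        · exact h
      rcases lt_or_ge v (x / 2) with hvx | hvx
      · have e1 : ee n r u ≤ (2 * 2) ^ n * ee n t x :=
          ee_comp' hn0 hr (by linarith) hu hx0 (by norm_num) htx (by linarith)
        refine fin_aux (K1 := (2 * 2) ^ n) (A1 := ee n t x) (B1 := gg D c s v) ?_ p4.le k4 q2
          (by linarith) q5 (by linarith)
        gcongr
      · have h1 : v ^ 2 < x ^ 2 - s := by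
          rw [div_lt_iff₀ hs] at hB
          have : x ^ 2 / t * s ≤ x ^ 2 := by
            rw [div_mul_eq_mul_div, div_le_iff₀ htp]
            gcongr; linarith
          nlinarith
        have h2 : t / 8 ≤ u * (2 * x) := by nlinarith
        have e1 : ee n r u ≤ (32 * (x ^ 2 / t)) ^ n * ee n t x := by
          refine ee_comp hn0 hr (by linarith) hu hx0 (by positivity) ?_
          have h3 : √t ≤ x := Real.sqrt_le_iff.2 ⟨hx0, htx⟩
          have h4 : 2 * x ≤ 32 * (x ^ 2 / t) * u := by
            rw [← mul_div_assoc, div_mul_eq_mul_div, le_div_iff₀ htp]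
            nlinarith
          have h5 : 0 ≤ 32 * (x ^ 2 / t) * √r := by positivity
          nlinarith
        have e2 : gg D (2 * c) s v ≤ gg D c s v * Real.exp (-(c / 4 * (x ^ 2 / t))) := by
          have : 2 * c = c + c := by ring
          rw [this, gg_split]
          refine mul_le_mul_of_nonneg_left (Real.exp_le_exp.2 ?_) q5
          have h3 : x ^ 2 / t / 4 ≤ v ^ 2 / s := by
            rw [div_div, div_le_div_iff₀ (by positivity) hs]
            have : (x / 2) ^ 2 ≤ v ^ 2 := by gcongr
            nlinarith [sq_nonneg x]
          have := mul_le_mul_of_nonneg_left h3 hc.le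
          have e1 : -c * v ^ 2 / s = - (c * (v ^ 2 / s)) := by ring
          rw [e1]; linarith
        have e3 := hexp (x ^ 2 / t) (by positivity)
        have e4 : (32 * (x ^ 2 / t)) ^ n ≤ 32 ^ n * (K2 * Real.exp (c / 4 * (x ^ 2 / t))) := by
          rw [Real.mul_rpow (by norm_num) (by positivity)]
          gcongr
          refine le_trans ?_ e3
          gcongr; linarith
        refine fin_aux (K1 := 32 ^ n * K2) (A1 := ee n t x) (B1 := gg D c s v) ?_ p5.le k5 q2
          (by linarith) q5 (by linarith)
        calc ee n r u * gg D (2 * c) s v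
          ≤ ((32 ^ n * (K2 * Real.exp (c / 4 * (x ^ 2 / t)))) * ee n t x) *
              (gg D c s v * Real.exp (-(c / 4 * (x ^ 2 / t)))) := by
                gcongr; exact e1.trans (by gcongr)
          _ = 32 ^ n * K2 * ee n t x * gg D c s v *
               (Real.exp (c / 4 * (x ^ 2 / t)) * Real.exp (-(c / 4 * (x ^ 2 / t)))) := by ring
          _ = _ := by rw [← Real.exp_add, add_neg_cancel, Real.exp_zero, mul_one]

lemma ee_ee {n : ℝ} (hn0 : 0 ≤ n) {r s u v : ℝ} (hr : 0 < r) (hs : 0 < s) (hu : 0 ≤ u) (hv : 0 ≤ v) :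
    ee n r u * ee n s v ≤ 2 ^ n * ee n (r + s) (u + v) * (ee n r u + ee n s v) := by
  have htp : 0 < r + s := by positivity
  have q2 := ee_nonneg n htp (by positivity : 0 ≤ u + v)
  have q4 := ee_nonneg n hr hu
  have q6 := ee_nonneg n hs hv
  have hsq : √(r + s) ≤ √r + √s := by
    rw [Real.sqrt_le_iff]
    refine ⟨by positivity, ?_⟩
    nlinarith [Real.sq_sqrt hr.le, Real.sq_sqrt hs.le, Real.sqrt_nonneg r, Real.sqrt_nonneg s,
      mul_nonneg (Real.sqrt_nonneg r) (Real.sqrt_nonneg s)]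
  rcases le_total (√r + u) (√s + v) with h | h
  · have e1 : ee n s v ≤ 2 ^ n * ee n (r + s) (u + v) :=
      ee_comp hn0 hs (by linarith) hv (by positivity) (by norm_num) (by linarith)
    calc _ ≤ ee n r u * (2 ^ n * ee n (r + s) (u + v)) := by gcongr
      _ = 2 ^ n * ee n (r + s) (u + v) * ee n r u := by ring
      _ ≤ _ := by gcongr; linarith
  · have e1 : ee n r u ≤ 2 ^ n * ee n (r + s) (u + v) :=
      ee_comp hn0 hr (by linarith) hu (by positivity) (by norm_num) (by linarith)
    calc _ ≤ (2 ^ n * ee n (r + s) (u + v)) * ee n s v := by gcongr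
      _ ≤ _ := by gcongr; linarith

/-- full three-point inequality -/
lemma threeP {D α c : ℝ} (hD : 0 ≤ D) (hα : 0 < α) (hα2 : α < 2) (hc : 0 < c) :
    ∃ K : ℝ, 1 ≤ K ∧ ∀ r s u v : ℝ, 0 < r → 0 < s → r + s ≤ 1 → 0 ≤ u → 0 ≤ v →
      (gg D (3 * c) r u + ee (D + α) r u) * (gg D (2 * c) s v + ee (D + α) s v) ≤
        K * (gg D (2 * c) (r + s) (u + v) + ee (D + α) (r + s) (u + v)) *
          ((gg D c r u + ee (D + α) r u) + (gg D c s v + ee (D + α) s v)) := by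
  obtain ⟨K1, hK1, h1⟩ := gg_gg hD hc
  obtain ⟨K2, hK2, h2⟩ := ee_gg hD hα hα2 hc
  have p1 : (0:ℝ) < 2 ^ (D + α) := by positivity
  refine ⟨K1 + K2 + K2 + 2 ^ (D + α), by linarith, ?_⟩
  intro r s u v hr hs hrs hu hv
  have h1 := h1 r s u v hr hs hu hv
  have h2' := h2 s r v u hs hr (by linarith) hv hu
  have h2 := h2 r s u v hr hs hrs hu hv
  rw [add_comm s r, add_comm v u] at h2'
  have h3 := ee_ee (n := D + α) (by positivity) hr hs hu hv
  have htp : 0 < r + s := by positivity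
  have hx0 : 0 ≤ u + v := by positivity
  have q1 := gg_nonneg D (2 * c) (u + v) htp
  have q2 := ee_nonneg (D + α) htp hx0
  have q3 := gg_nonneg D c u hr
  have q4 := ee_nonneg (D + α) hr hu
  have q5 := gg_nonneg D c v hs
  have q6 := ee_nonneg (D + α) hs hv
  have m1 : gg D (3 * c) r u ≤ gg D (2 * c) r u := gg_mono hr (by linarith)
  set n := D + α
  set A := gg D (2 * c) (r + s) (u + v)
  set E := ee n (r + s) (u + v)
  set Hr := gg D c r u
  set Hs := gg D c s v
  set er := ee n r u
  set es := ee n s v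
  have j1 : gg D (3 * c) r u * gg D (2 * c) s v ≤ K1 * (A + E) * ((Hr + er) + (Hs + es)) :=
    fin_aux h1 (by linarith) le_rfl q1 (by linarith) (by linarith) (by linarith)
  have j2 : gg D (3 * c) r u * es ≤ K2 * (A + E) * ((Hr + er) + (Hs + es)) := by
    calc _ ≤ gg D (2 * c) r u * es := by gcongr
      _ = es * gg D (2 * c) r u := by ring
      _ ≤ _ := h2'
      _ = _ := by ring
  have j3 : er * es ≤ 2 ^ n * (A + E) * ((Hr + er) + (Hs + es)) :=
    fin_aux h3 (by linarith) le_rfl q2 (by linarith) (by linarith) (by linarith)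
  calc _ = gg D (3 * c) r u * gg D (2 * c) s v + gg D (3 * c) r u * es
        + er * gg D (2 * c) s v + er * es := by ring
    _ ≤ K1 * (A + E) * ((Hr + er) + (Hs + es)) + K2 * (A + E) * ((Hr + er) + (Hs + es))
        + K2 * (A + E) * ((Hr + er) + (Hs + es)) + 2 ^ n * (A + E) * ((Hr + er) + (Hs + es)) := by
        linarith
    _ = _ := by ring

set_option maxHeartbeats 1000000 in
lemma tri {D α c : ℝ} (hD : 0 ≤ D) (hα : 0 < α) (hα2 : α < 2) (hc : 0 < c) :
    ∃ K : ℝ, 1 ≤ K ∧ ∀ r s u v : ℝ, 0 < r → 0 < s → r + s ≤ 1 → 0 ≤ u → 0 ≤ v →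
      gg D (3 * c) r u ≤ K * gg D (2 * c) (r + s) (u + v) ∨
      gg D (3 * c) r u * ee (D + α) s v ≤ K * ee (D + α) (r + s) (u + v) * gg D c r u := by
  obtain ⟨K2, hK2, hexp⟩ := one_add_rpow_le_exp (D + α) (2 * c) (by positivity)
  set n := D + α with hn
  have hn0 : 0 ≤ n := by positivity
  have p1 : (0:ℝ) < 2 ^ (D / 2) * Real.exp 0 := by positivity
  have p2 : (0:ℝ) < 2 ^ (D / 2) * Real.exp (2 * c) := by positivity
  have p3 : (0:ℝ) < (2 * 6) ^ n := by positivity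
  have p4 : (0:ℝ) < 6 ^ n := by positivity
  have p5 : (0:ℝ) < 4 ^ n * K2 := by positivity
  obtain ⟨K, hK, k1, k2, k3, k4, k5⟩ := exK5 (2 ^ (D / 2) * Real.exp 0) (2 ^ (D / 2) * Real.exp (2 * c))
    ((2 * 6) ^ n) (6 ^ n) (4 ^ n * K2)
  refine ⟨K, hK, ?_⟩
  intro r s u v hr hs hrs hu hv
  set t := r + s with ht
  set x := u + v with hx
  have htp : 0 < t := by positivity
  have hx0 : 0 ≤ x := by positivity
  have q1 := gg_nonneg D (2 * c) x htp
  have q2 := ee_nonneg n htp hx0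
  have q3 := gg_nonneg D c u hr
  have q6 := ee_nonneg n hs hv
  have m1 : gg D (3 * c) r u ≤ gg D c r u := gg_mono hr (by linarith)
  have fin2 : ∀ K1, 0 ≤ K1 → K1 ≤ K →
      ee n s v ≤ K1 * ee n t x → gg D (3 * c) r u * ee n s v ≤ K * ee n t x * gg D c r u := by
    intro K1 h0 h1 h2
    refine fin_aux (K1 := K1) (A1 := ee n t x) (B1 := gg D c r u) ?_ h0 h1 q2 le_rfl q3 le_rfl
    rw [mul_comm]
    have := gg_nonneg D (3 * c) u hr
    gcongr
  rcases le_or_gt (t / 2) r with hr2 | hr2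
  · rcases le_or_gt (x / 6) v with hvx | hvx
    · rcases le_or_gt (x ^ 2) t with hxt | hxt
      · left
        have : gg D (3 * c) r u ≤ 2 ^ (D / 2) * Real.exp (2 * c) * gg D (2 * c) t x := by
          refine gg_comp hD (by norm_num) hr htp (by linarith) ?_
          have h1 : x ^ 2 / t ≤ 1 := by rw [div_le_one htp]; exact hxt
          have h2 : 0 ≤ 3 * c * u ^ 2 / r := by positivity
          rw [mul_div_assoc]; nlinarith
        exact this.trans (by gcongr)
      · right
        exact fin2 _ p3.le k3
          (ee_comp' hn0 hs (by linarith) hv hx0 (by norm_num) hxt.le (by linarith))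
    · left
      have : gg D (3 * c) r u ≤ 2 ^ (D / 2) * Real.exp 0 * gg D (2 * c) t x := by
        refine gg_comp hD (by norm_num) hr htp (by linarith) ?_
        rw [add_zero, div_le_div_iff₀ htp hr]
        have h5 : 5 * x / 6 ≤ u := by linarith
        have : (5 * x / 6) ^ 2 ≤ u ^ 2 := by gcongr
        have h6 : 2 * x ^ 2 ≤ 3 * u ^ 2 := by nlinarith [sq_nonneg x]
        have : r ≤ t := by linarith
        calc 2 * c * x ^ 2 * r = c * (2 * x ^ 2) * r := by ring
          _ ≤ c * (3 * u ^ 2) * t := by gcongr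
          _ = _ := by ring
      exact this.trans (by gcongr)
  · right
    rcases le_or_gt (x / 6) v with hvx | hvx
    · refine fin2 _ p4.le k4 (ee_comp hn0 hs (by linarith) hv hx0 (by norm_num) ?_)
      have := sqrt_aux (r := s) (t := t) (κ := 2) hs.le (by norm_num) (by linarith)
      linarith [Real.sqrt_nonneg s]
    · have h5 : 5 * x / 6 ≤ u := by linarith
      have h51 : (5 * x / 6) ^ 2 ≤ u ^ 2 := by gcongr
      have e1 : ee n s v ≤ (4 * (1 + x ^ 2 / t)) ^ n * ee n t x := by
        refine ee_comp hn0 hs (by linarith) hv hx0 (by positivity) ?_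
        have h1 := sqrt_aux (r := s) (t := t) (κ := 2) hs.le (by norm_num) (by linarith)
        have h2 : x ≤ (1 + x ^ 2 / t) * √t := by
          have h3 : 0 < √t := by positivity
          have h4 : x ^ 2 / t = (x / √t) ^ 2 := by rw [div_pow, Real.sq_sqrt htp.le]
          have h6 : x / √t ≤ 1 + x ^ 2 / t := by rw [h4]; nlinarith [sq_nonneg (x / √t - 1)]
          rwa [div_le_iff₀ h3] at h6
        have h3 : 0 ≤ x ^ 2 / t := by positivity
        have h6 : (1 + x ^ 2 / t) * √t ≤ (1 + x ^ 2 / t) * (2 * √s) := by gcongr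
        have h7 : √t ≤ (1 + x ^ 2 / t) * √t := by nlinarith [Real.sqrt_nonneg t]
        have h8 : 0 ≤ 4 * (1 + x ^ 2 / t) * v := by positivity
        nlinarith
      have e2 : gg D (3 * c) r u ≤ gg D c r u * Real.exp (-(2 * c * (x ^ 2 / t))) := by
        have : 3 * c = c + 2 * c := by ring
        rw [this, gg_split]
        refine mul_le_mul_of_nonneg_left (Real.exp_le_exp.2 ?_) q3
        have h3 : x ^ 2 / t ≤ u ^ 2 / r := by
          rw [div_le_div_iff₀ htp hr]
          nlinarith [sq_nonneg x]
        have := mul_le_mul_of_nonneg_left h3 (by positivity : 0 ≤ 2 * c)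
        have e1 : -(2 * c) * u ^ 2 / r = - (2 * c * (u ^ 2 / r)) := by ring
        rw [e1]; linarith
      have e3 := hexp (x ^ 2 / t) (by positivity)
      have e4 : (4 * (1 + x ^ 2 / t)) ^ n ≤ 4 ^ n * (K2 * Real.exp (2 * c * (x ^ 2 / t))) := by
        rw [Real.mul_rpow (by norm_num) (by positivity)]
        gcongr
      refine fin_aux (K1 := 4 ^ n * K2) (A1 := ee n t x) (B1 := gg D c r u) ?_ p5.le k5 q2
          le_rfl q3 le_rfl
      calc gg D (3 * c) r u * ee n s v
          ≤ (gg D c r u * Real.exp (-(2 * c * (x ^ 2 / t)))) *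
            ((4 ^ n * (K2 * Real.exp (2 * c * (x ^ 2 / t)))) * ee n t x) := by
                gcongr; exact e1.trans (by gcongr)
          _ = 4 ^ n * K2 * ee n t x * gg D c r u *
               (Real.exp (2 * c * (x ^ 2 / t)) * Real.exp (-(2 * c * (x ^ 2 / t)))) := by ring
          _ = _ := by rw [← Real.exp_add, add_neg_cancel, Real.exp_zero, mul_one]


lemma pw0 {D α c : ℝ} (hD : 0 ≤ D) (hα : 0 < α) (hα2 : α < 2) (hc : 0 < c) :
    ∃ K : ℝ, 1 ≤ K ∧ ∀ r s u v Q A B : ℝ, 0 < r → 0 < s → r + s ≤ 1 → 0 ≤ u → 0 ≤ v →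
      0 ≤ Q → 0 ≤ A → 0 ≤ B →
      Q ≤ A * (gg D (2 * c) s v + ee (D + α) s v) + B * ee (D + α) s v →
      (gg D (3 * c) r u + ee (D + α) r u) * Q ≤
        K * ((gg D (2 * c) (r + s) (u + v) + ee (D + α) (r + s) (u + v)) *
          (Q + A * ((gg D c r u + ee (D + α) r u) + (gg D c s v + ee (D + α) s v))) +
          B * ee (D + α) (r + s) (u + v) *
            ((gg D c r u + ee (D + α) r u) + (gg D c s v + ee (D + α) s v))) := by
  obtain ⟨K3, hK3, h3⟩ := threeP hD hα hα2 hc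
  obtain ⟨Kt, hKt, ht⟩ := tri hD hα hα2 hc
  have p1 : (0:ℝ) < 2 ^ (D + α) := by positivity
  refine ⟨K3 + Kt + 2 ^ (D + α), by linarith, ?_⟩
  intro r s u v Q A B hr hs hrs hu hv hQ hA hB hQle
  have h3 := h3 r s u v hr hs hrs hu hv
  have ht := ht r s u v hr hs hrs hu hv
  have h4 := ee_ee (n := D + α) (by positivity) hr hs hu hv
  have htp : 0 < r + s := by positivity
  have hx0 : 0 ≤ u + v := by positivity
  have q1 := gg_nonneg D (2 * c) (u + v) htp
  have q2 := ee_nonneg (D + α) htp hx0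
  have q3 := gg_nonneg D c u hr
  have q4 := ee_nonneg (D + α) hr hu
  have q5 := gg_nonneg D c v hs
  have q6 := ee_nonneg (D + α) hs hv
  have q7 := gg_nonneg D (3 * c) u hr
  have q8 := gg_nonneg D (2 * c) v hs
  set n := D + α
  set E := ee n (r + s) (u + v)
  set P := gg D (2 * c) (r + s) (u + v) + E with hP
  set er := ee n r u
  set es := ee n s v
  set W := (gg D c r u + er) + (gg D c s v + es) with hW
  set g3 := gg D (3 * c) r u
  set pa := gg D (2 * c) s v + es with hpa
  have hP0 : 0 ≤ P := by positivity
  have hW0 : 0 ≤ W := by positivity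
  have hpa0 : 0 ≤ pa := by positivity
  have hPQ : 0 ≤ P * Q := by positivity
  have hPAW : 0 ≤ P * (A * W) := by positivity
  have hBEW : 0 ≤ B * E * W := by positivity
  have j1 : er * es ≤ 2 ^ n * E * W :=
    fin_aux h4 p1.le le_rfl q2 le_rfl (by positivity) (by linarith)
  have j1' : B * (er * es) ≤ 2 ^ n * (B * E * W) := by
    calc _ ≤ B * (2 ^ n * E * W) := by gcongr
      _ = _ := by ring
  have j3 : A * ((g3 + er) * pa) ≤ K3 * (P * (A * W)) := by
    calc _ ≤ A * (K3 * P * W) := by gcongr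
      _ = _ := by ring
  have exp : (K3 + Kt + 2 ^ n) * (P * (Q + A * W) + B * E * W) =
     K3 * (P * Q) + Kt * (P * Q) + 2 ^ n * (P * Q) + K3 * (P * (A * W)) + Kt * (P * (A * W))
      + 2 ^ n * (P * (A * W)) + K3 * (B * E * W) + Kt * (B * E * W) + 2 ^ n * (B * E * W) := by ring
  rw [exp]
  have z1 : 0 ≤ K3 * (P * Q) := by positivity
  have z2 : 0 ≤ Kt * (P * Q) := by positivity
  have z3 : 0 ≤ 2 ^ n * (P * Q) := by positivity
  have z4 : 0 ≤ K3 * (P * (A * W)) := by positivity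
  have z5 : 0 ≤ Kt * (P * (A * W)) := by positivity
  have z6 : 0 ≤ 2 ^ n * (P * (A * W)) := by positivity
  have z7 : 0 ≤ K3 * (B * E * W) := by positivity
  have z8 : 0 ≤ Kt * (B * E * W) := by positivity
  have z9 : 0 ≤ 2 ^ n * (B * E * W) := by positivity
  rcases ht with ht | ht
  · have l1 : g3 * Q ≤ Kt * (P * Q) := by
      calc _ ≤ (Kt * gg D (2 * c) (r + s) (u + v)) * Q := by gcongr
        _ ≤ (Kt * P) * Q := by gcongr; linarith
        _ = _ := by ring
    have l2 : er * Q ≤ A * ((g3 + er) * pa) + B * (er * es) := by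
      calc er * Q ≤ er * (A * pa + B * es) := by gcongr
        _ = A * (er * pa) + B * (er * es) := by ring
        _ ≤ _ := by gcongr; linarith
    have : (g3 + er) * Q = g3 * Q + er * Q := by ring
    rw [this]; linarith
  · have l1 : B * (g3 * es) ≤ Kt * (B * E * W) := by
      calc _ ≤ B * (Kt * E * gg D c r u) := by gcongr
        _ ≤ B * (Kt * E * W) := by gcongr; linarith
        _ = _ := by ring
    have : (g3 + er) * Q ≤ A * ((g3 + er) * pa) + (B * (g3 * es) + B * (er * es)) := by
      calc (g3 + er) * Q ≤ (g3 + er) * (A * pa + B * es) := by gcongr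
        _ = _ := by ring
    linarith

/-- the near-diagonal case `x² ≤ t` -/
lemma pw1 {D α c : ℝ} (hD : 0 ≤ D) (hα : 0 < α) (hα2 : α < 2) (hc : 0 < c) :
    ∃ K : ℝ, 1 ≤ K ∧ ∀ r s u v x Q A B : ℝ, 0 < r → 0 < s → r + s ≤ 1 → 0 ≤ u → 0 ≤ v → 0 ≤ x →
      x ^ 2 ≤ r + s → 0 ≤ Q → 0 ≤ A → 0 ≤ B →
      Q ≤ A * (gg D (2 * c) s v + ee (D + α) s v) + B * ee (D + α) s v →
      (gg D (3 * c) r u + ee (D + α) r u) * Q ≤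
        K * ((gg D (2 * c) (r + s) x + ee (D + α) (r + s) x) *
          (Q + A * ((gg D c r u + ee (D + α) r u) + (gg D c s v + ee (D + α) s v))) +
          B * ee (D + α) (r + s) x *
            ((gg D c r u + ee (D + α) r u) + (gg D c s v + ee (D + α) s v))) := by
  obtain ⟨K, hK, k1, k2, -, -, -⟩ := exK5 (2 * (2 ^ (D / 2) * Real.exp (2 * c))) (4 ^ (D + α)) 0 0 0
  refine ⟨K, hK, ?_⟩
  intro r s u v x Q A B hr hs hrs hu hv hx hxt hQ hA hB hQle
  have htp : 0 < r + s := by positivity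
  set t := r + s with ht
  set n := D + α with hn
  have hn0 : 0 ≤ n := by positivity
  have q1 := gg_nonneg D (2 * c) x htp
  have q2 := ee_nonneg n htp hx
  have q3 := gg_nonneg D c u hr
  have q4 := ee_nonneg n hr hu
  have q5 := gg_nonneg D c v hs
  have q6 := ee_nonneg n hs hv
  have q7 := gg_nonneg D (3 * c) u hr
  have q8 := gg_nonneg D (2 * c) v hs
  have m1 : gg D (3 * c) r u ≤ gg D c r u := gg_mono hr (by linarith)
  have base : t ^ (-D / 2) ≤ Real.exp (2 * c) * gg D (2 * c) t x := by
    unfold gg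
    rw [mul_left_comm, ← Real.exp_add]
    refine le_mul_of_one_le_right (by positivity) (Real.one_le_exp ?_)
    have h1 : x ^ 2 / t ≤ 1 := by rw [div_le_one htp]; exact hxt
    rw [mul_div_assoc]; nlinarith
  have gen : ∀ s' c' v', 0 < s' → s' ≤ 1 → t ≤ 2 * s' → 0 ≤ c' → 0 ≤ v' →
      gg D c' s' v' + ee n s' v' ≤ K * gg D (2 * c) t x := by
    intro s' c' v' h1 h1' h2 h3 h4
    have e1 := gg_le (D := D) (u := v') h3 h1
    have e2 := ee_le hD hα hα2 h1 h1' h4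
    have e3 := rp_comp hD (by norm_num : (0:ℝ) < 2) h1 htp h2
    calc _ ≤ 2 * s' ^ (-D / 2) := by linarith
      _ ≤ 2 * (2 ^ (D / 2) * (Real.exp (2 * c) * gg D (2 * c) t x)) := by
        gcongr; exact e3.trans (by gcongr)
      _ = (2 * (2 ^ (D / 2) * Real.exp (2 * c))) * gg D (2 * c) t x := by ring
      _ ≤ _ := by gcongr
  set E := ee n t x
  set P := gg D (2 * c) t x + E with hP
  set er := ee n r u
  set es := ee n s v
  set W := (gg D c r u + er) + (gg D c s v + es) with hW
  set g3 := gg D (3 * c) r u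
  set pa := gg D (2 * c) s v + es with hpa
  have hP0 : 0 ≤ P := by positivity
  have hW0 : 0 ≤ W := by positivity
  have hpa0 : 0 ≤ pa := by positivity
  have hPQ : 0 ≤ K * (P * Q) := by positivity
  have hPAW : 0 ≤ K * (P * (A * W)) := by positivity
  have hBEW : 0 ≤ K * (B * E * W) := by positivity
  rcases le_total s r with h | h
  · have l1 : (g3 + er) * Q ≤ K * (P * Q) := by
      have := gen r (3 * c) u hr (by linarith) (by linarith) (by positivity) hu
      calc _ ≤ (K * gg D (2 * c) t x) * Q := by gcongr
        _ ≤ (K * P) * Q := by gcongr; linarith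
        _ = _ := by ring
    nlinarith
  · have l1 : pa ≤ K * P := by
      have := gen s (2 * c) v hs (by linarith) (by linarith) (by positivity) hv
      refine this.trans ?_
      gcongr; linarith
    have l2 : es ≤ K * E := by
      have : es ≤ 4 ^ n * E := by
        refine ee_comp hn0 hs (by linarith) hv hx (by norm_num) ?_
        have := sqrt_aux (r := s) (t := t) (κ := 2) hs.le (by norm_num) (by linarith)
        have h2 : x ≤ √t := Real.le_sqrt_of_sq_le hxt
        linarith
      exact this.trans (by gcongr)
    have l3 : (g3 + er) * Q ≤ K * (P * (A * W)) + K * (B * E * W) := by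
      calc (g3 + er) * Q ≤ W * (A * (K * P) + B * (K * E)) := by
            gcongr
            · linarith
            · exact hQle.trans (by gcongr)
        _ = _ := by ring
    nlinarith

set_option maxHeartbeats 1000000 in
/-- the large jump case -/
lemma pw2 {D α c : ℝ} (hD : 0 ≤ D) (hα : 0 < α) (hα2 : α < 2) (hc : 0 < c) :
    ∃ K : ℝ, 1 ≤ K ∧ ∀ r s u v x h Q A B : ℝ, 0 < r → 0 < s → r + s ≤ 1 → 0 ≤ u → 0 ≤ v → 0 ≤ x →
      0 ≤ h → x ≤ u + v + h → 
      r + s < x ^ 2 → r + s ≤ h * x → 0 ≤ Q → 0 ≤ A → 0 ≤ B →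
      Q ≤ A * (gg D (2 * c) s v + ee (D + α) s v) + B * ee (D + α) s v →
      (gg D (3 * c) r u + ee (D + α) r u) * Q ≤
        K * (ee (D + α) (r + s) x * Q + (A + B) * ee (D + α) (r + s) x * (gg D c r u + ee (D + α) r u)
          + (ee (D + α) (r + s) x / (r + s) * h ^ (D + α)) *
            ((gg D c r u + ee (D + α) r u) * (Q + A * (gg D c s v + ee (D + α) s v)))) := by
  obtain ⟨K2, hK2, hexp⟩ := one_add_rpow_le_exp (D + α) (c / 9) (by positivity)
  obtain ⟨K, hK, k1, k2, k3, -, -⟩ := exK5 (6 ^ (D + α)) (2 ^ (D + α) * K2) ((2 * 3) ^ (D + α)) 0 0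
  refine ⟨K, hK, ?_⟩
  intro r s u v x h Q A B hr hs hrs hu hv hx hh hxle hxt hhx hQ hA hB hQle
  have htp : 0 < r + s := by positivity
  set t := r + s with ht
  set n := D + α with hn
  have hn0 : 0 ≤ n := by positivity
  have hxpos : 0 < x := by
    rcases hx.eq_or_lt with h | h
    · rw [← h] at hxt; nlinarith
    · exact h
  have hhpos : 0 < h := by
    rcases hh.eq_or_lt with h' | h'
    · rw [← h'] at hhx; nlinarith
    · exact h'
  have q2 := ee_nonneg n htp hx
  have q3 := gg_nonneg D c u hr
  have q4 := ee_nonneg n hr hu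
  have q5 := gg_nonneg D c v hs
  have q6 := ee_nonneg n hs hv
  have q7 := gg_nonneg D (3 * c) u hr
  have q8 := gg_nonneg D (2 * c) v hs
  have m1 : gg D (3 * c) r u ≤ gg D c r u := gg_mono hr (by linarith)
  have m2 : gg D (3 * c) r u ≤ gg D (2 * c) r u := gg_mono hr (by linarith)
  have hsq : √t ≤ x := Real.sqrt_le_iff.2 ⟨hx, hxt.le⟩
  set J := ee n t x / t * h ^ n with hJ
  have hJ0 : 0 ≤ J := by positivity
  have hJe : J = (h / (√t + x)) ^ n := by
    rw [hJ, Real.div_rpow hh (by positivity)]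
    unfold ee; field_simp
  have hJ1 : (h / (2 * x)) ^ n ≤ J := by
    rw [hJe]
    refine Real.rpow_le_rpow (by positivity) ?_ hn0
    gcongr; linarith
  -- Gaussian times jump
  have gj : ∀ s' v', 0 < s' → s' ≤ t → 0 ≤ v' → x ≤ 3 * v' →
      gg D (2 * c) s' v' ≤ K * gg D c s' v' * J := by
    intro s' v' hs' hst hv' hxv
    have g0 := gg_nonneg D c v' hs'
    have e2 : gg D (2 * c) s' v' ≤ gg D c s' v' * Real.exp (-(c / 9 * (x ^ 2 / t))) := by
      have : 2 * c = c + c := by ring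
      rw [this, gg_split]
      refine mul_le_mul_of_nonneg_left (Real.exp_le_exp.2 ?_) g0
      have h3 : x ^ 2 / t / 9 ≤ v' ^ 2 / s' := by
        rw [div_div, div_le_div_iff₀ (by positivity) hs']
        have : x ^ 2 ≤ (3 * v') ^ 2 := by gcongr
        calc x ^ 2 * s' ≤ (3 * v') ^ 2 * t := by gcongr
          _ = _ := by ring
      have := mul_le_mul_of_nonneg_left h3 hc.le
      have e1 : -c * v' ^ 2 / s' = - (c * (v' ^ 2 / s')) := by ring
      rw [e1]; linarith
    have e3 := hexp (x ^ 2 / t) (by positivity)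
    have e4 : 1 ≤ (2 * (1 + x ^ 2 / t)) ^ n * J := by
      calc (1:ℝ) = 1 ^ n := by simp
        _ ≤ ((2 * (1 + x ^ 2 / t)) * (h / (2 * x))) ^ n := by
          refine Real.rpow_le_rpow (by norm_num) ?_ hn0
          have : 1 ≤ (2 * (x ^ 2 / t)) * (h / (2 * x)) := by
            have : (2 * (x ^ 2 / t)) * (h / (2 * x)) = (h * x) / t := by field_simp
            rw [this, le_div_iff₀ htp]; linarith
          refine this.trans ?_
          gcongr; linarith
        _ = (2 * (1 + x ^ 2 / t)) ^ n * (h / (2 * x)) ^ n := Real.mul_rpow (by positivity) (by positivity)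
        _ ≤ _ := by gcongr
    have e5 : (2 * (1 + x ^ 2 / t)) ^ n ≤ K * Real.exp (c / 9 * (x ^ 2 / t)) := by
      rw [Real.mul_rpow (by norm_num) (by positivity)]
      calc 2 ^ n * (1 + x ^ 2 / t) ^ n ≤ 2 ^ n * (K2 * Real.exp (c / 9 * (x ^ 2 / t))) := by gcongr
        _ = (2 ^ n * K2) * Real.exp (c / 9 * (x ^ 2 / t)) := by ring
        _ ≤ _ := by gcongr
    have e6 : Real.exp (-(c / 9 * (x ^ 2 / t))) ≤ K * J := by
      rw [Real.exp_neg, inv_le_iff_one_le_mul₀ (Real.exp_pos _)]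
      calc 1 ≤ _ := e4
        _ ≤ (K * Real.exp (c / 9 * (x ^ 2 / t))) * J := by gcongr
        _ = _ := by ring
    calc _ ≤ _ := e2
      _ ≤ gg D c s' v' * (K * J) := by gcongr
      _ = _ := by ring
  set E := ee n t x
  set er := ee n r u
  set es := ee n s v
  set Hr := gg D c r u + er with hHr
  set Hs := gg D c s v + es with hHs
  set g3 := gg D (3 * c) r u
  have hHr0 : 0 ≤ Hr := by positivity
  have hHs0 : 0 ≤ Hs := by positivity
  have z1 : 0 ≤ K * (E * Q) := by positivity
  have z2 : 0 ≤ K * ((A + B) * E * Hr) := by positivity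
  have z3 : 0 ≤ K * (J * (Hr * Q)) := by positivity
  have z4 : 0 ≤ K * (J * (Hr * (A * Hs))) := by positivity
  have expd : K * (E * Q + (A + B) * E * Hr + J * (Hr * (Q + A * Hs))) =
    K * (E * Q) + K * ((A + B) * E * Hr) + K * (J * (Hr * Q)) + K * (J * (Hr * (A * Hs))) := by ring
  rw [expd]
  rcases le_or_gt x (3 * h) with c1 | c1
  · have : 1 ≤ K * J := by
      calc (1:ℝ) = 1 ^ n := by simp
        _ ≤ (6 * (h / (2 * x))) ^ n := by
          refine Real.rpow_le_rpow (by norm_num) ?_ hn0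
          rw [← mul_div_assoc, le_div_iff₀ (by positivity)]; linarith
        _ = 6 ^ n * (h / (2 * x)) ^ n := Real.mul_rpow (by positivity) (by positivity)
        _ ≤ _ := by gcongr
    have : (g3 + er) * Q ≤ K * (J * (Hr * Q)) := by
      calc _ ≤ Hr * Q := by gcongr; linarith
        _ ≤ (K * J) * (Hr * Q) := le_mul_of_one_le_left (by positivity) this
        _ = _ := by ring
    linarith
  · rcases le_or_gt x (3 * u) with c2 | c2
    · have l1 : er * Q ≤ K * (E * Q) := by
        have : er ≤ (2 * 3) ^ n * E :=
          ee_comp' hn0 hr (by linarith) hu hx (by norm_num) hxt.le c2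
        calc _ ≤ ((2 * 3) ^ n * E) * Q := by gcongr
          _ ≤ (K * E) * Q := by gcongr
          _ = _ := by ring
      have l2 : g3 * Q ≤ K * (J * (Hr * Q)) := by
        calc g3 * Q ≤ (K * gg D c r u * J) * Q := by
              gcongr; exact m2.trans (gj r u hr (by linarith) hu c2)
          _ ≤ (K * Hr * J) * Q := by gcongr; linarith
          _ = _ := by ring
      nlinarith
    · have l1 : es ≤ K * E := by
        have : es ≤ (2 * 3) ^ n * E :=
          ee_comp' hn0 hs (by linarith) hv hx (by norm_num) hxt.le (by linarith)
        exact this.trans (by gcongr)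
      have l2 : gg D (2 * c) s v ≤ K * Hs * J := by
        refine (gj s v hs (by linarith) hv (by linarith)).trans ?_
        gcongr; linarith
      have : (g3 + er) * Q ≤ K * ((A + B) * E * Hr) + K * (J * (Hr * (A * Hs))) := by
        calc (g3 + er) * Q ≤ Hr * (A * (K * Hs * J + K * E) + B * (K * E)) := by
              gcongr
              · linarith
              · exact hQle.trans (by gcongr)
          _ = _ := by ring
      linarith

set_option maxHeartbeats 1000000 in
lemma pw {D α c : ℝ} (hD : 0 ≤ D) (hα : 0 < α) (hα2 : α < 2) (hc : 0 < c) :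
    ∃ K : ℝ, 1 ≤ K ∧ ∀ r s u v x h Q A B : ℝ, 0 < r → 0 < s → r + s ≤ 1 → 0 ≤ u → 0 ≤ v → 0 ≤ x →
      0 ≤ h → x ≤ u + v + h → 0 ≤ Q → 0 ≤ A → 0 ≤ B →
      Q ≤ A * (gg D (2 * c) s v + ee (D + α) s v) + B * ee (D + α) s v →
      (gg D (3 * c) r u + ee (D + α) r u) * Q ≤
        K * ((gg D (2 * c) (r + s) x + ee (D + α) (r + s) x) *
          (Q + A * ((gg D c r u + ee (D + α) r u) + (gg D c s v + ee (D + α) s v))) +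
          B * ee (D + α) (r + s) x *
            ((gg D c r u + ee (D + α) r u) + (gg D c s v + ee (D + α) s v))
          + (ee (D + α) (r + s) x / (r + s) * h ^ (D + α)) *
            ((gg D c r u + ee (D + α) r u) * (Q + A * (gg D c s v + ee (D + α) s v)))) := by
  obtain ⟨K0, hK0, h0⟩ := pw0 hD hα hα2 hc
  obtain ⟨K1, hK1, h1⟩ := pw1 hD hα hα2 hc
  obtain ⟨K2, hK2, h2⟩ := pw2 hD hα hα2 hc
  obtain ⟨K, hK, k1, k2, k3, -, -⟩ := exK5 (K0 * Real.exp (4 * c) + K0 * 2 ^ (D + α)) K1 K2 0 0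
  refine ⟨K, hK, ?_⟩
  intro r s u v x h Q A B hr hs hrs hu hv hx hh hxle hQ hA hB hQle
  have htp : 0 < r + s := by positivity
  have h0 := h0 r s u v Q A B hr hs hrs hu hv hQ hA hB hQle
  have h1 := h1 r s u v x Q A B hr hs hrs hu hv hx
  have h2 := h2 r s u v x h Q A B hr hs hrs hu hv hx hh hxle
  set t := r + s with ht
  set n := D + α with hn
  have hn0 : 0 ≤ n := by positivity
  have q1 := gg_nonneg D (2 * c) x htp
  have q2 := ee_nonneg n htp hx
  have q3 := gg_nonneg D c u hr
  have q4 := ee_nonneg n hr hu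
  have q5 := gg_nonneg D c v hs
  have q6 := ee_nonneg n hs hv
  have q9 := gg_nonneg D (2 * c) (u + v) htp
  have q10 := ee_nonneg n htp (by positivity : 0 ≤ u + v)
  have cmp : t < x ^ 2 → h * x < t → gg D (2 * c) t (u + v) ≤ Real.exp (4 * c) * gg D (2 * c) t x ∧
      ee n t (u + v) ≤ 2 ^ n * ee n t x := by
    intro a1 a2
    have hhx : h ≤ x := by nlinarith
    have hsq : √t ≤ x := Real.sqrt_le_iff.2 ⟨hx, a1.le⟩
    have hst : h ≤ √t := by
      have := Real.sq_sqrt htp.le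
      have : 0 < √t := by positivity
      nlinarith
    constructor
    · have := gg_comp (D := D) (κ := 1) (c := 2 * c) (c' := 2 * c) (b := 4 * c) (v := u + v) (x := x) hD
        (by norm_num) htp htp (by linarith) (by
          have e1 : x ^ 2 ≤ (u + v) ^ 2 + 2 * t := by
            have : (x - h) ^ 2 ≤ (u + v) ^ 2 := by
              have : x - h ≤ u + v := by linarith
              have : 0 ≤ x - h := by linarith
              gcongr
            nlinarith
          rw [div_le_iff₀ htp, add_mul, div_mul_cancel₀ _ htp.ne']
          nlinarith)
      simpa using this
    · refine ee_comp hn0 htp le_rfl (by positivity) hx (by norm_num) ?_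
      linarith
  set E := ee n t x
  set G := gg D (2 * c) t x
  set Hr := gg D c r u + ee n r u with hHr
  set Hs := gg D c s v + ee n s v with hHs
  have hHr0 : 0 ≤ Hr := by positivity
  have hHs0 : 0 ≤ Hs := by positivity
  have hE : 0 ≤ E / t * h ^ n * (Hr * (Q + A * Hs)) := by positivity
  have hM : 0 ≤ (G + E) * (Q + A * (Hr + Hs)) + B * E * (Hr + Hs) := by positivity
  rcases le_or_gt (x ^ 2) t with c1 | c1
  · refine (h1 c1 hQ hA hB hQle).trans ?_
    refine (mul_le_mul_of_nonneg_right k2 hM).trans ?_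
    exact mul_le_mul_of_nonneg_left (by linarith) (by linarith)
  · rcases le_or_gt t (h * x) with c2 | c2
    · refine (h2 c1 c2 hQ hA hB hQle).trans ?_
      have : E * Q + (A + B) * E * Hr ≤ (G + E) * (Q + A * (Hr + Hs)) + B * E * (Hr + Hs) := by
        have a1 : 0 ≤ G * (Q + A * (Hr + Hs)) := by positivity
        have a2 : 0 ≤ E * (A * Hs) := by positivity
        have a3 : 0 ≤ B * E * Hs := by positivity
        nlinarith
      gcongr
    · obtain ⟨g1, g2⟩ := cmp c1 c2
      refine h0.trans ?_
      set M1 := Real.exp (4 * c) with hM1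
      have hM1p : 0 < M1 := Real.exp_pos _
      set M2 : ℝ := 2 ^ n with hM2
      have hM2p : 0 < M2 := by positivity
      have t1 : gg D (2 * c) t (u + v) + ee n t (u + v) ≤ (M1 + M2) * (G + E) := by nlinarith
      have t2 : ee n t (u + v) ≤ (M1 + M2) * E := by nlinarith
      calc K0 * ((gg D (2 * c) t (u + v) + ee n t (u + v)) * (Q + A * (Hr + Hs)) + B * ee n t (u + v) * (Hr + Hs))
          ≤ K0 * (((M1 + M2) * (G + E)) * (Q + A * (Hr + Hs)) + B * ((M1 + M2) * E) * (Hr + Hs)) := by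
            gcongr
        _ = (K0 * M1 + K0 * M2) * ((G + E) * (Q + A * (Hr + Hs)) + B * E * (Hr + Hs)) := by ring
        _ ≤ K * ((G + E) * (Q + A * (Hr + Hs)) + B * E * (Hr + Hs)) := by gcongr
        _ ≤ _ := mul_le_mul_of_nonneg_left (by linarith) (by linarith)


noncomputable def hE (d : ℕ) (n c r : ℝ) (u : EuclideanSpace ℝ (Fin d)) : ℝ≥0∞ :=
  ENNReal.ofReal (gg d c r ‖u‖ + ee n r ‖u‖)

noncomputable def eE (d : ℕ) (n r : ℝ) (u : EuclideanSpace ℝ (Fin d)) : ℝ≥0∞ :=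
  ENNReal.ofReal (ee n r ‖u‖)

noncomputable def PE (d : ℕ) (n c r : ℝ) (u : EuclideanSpace ℝ (Fin d)) : ℝ≥0∞ :=
  if 0 < r then hE d n c r u else 0

lemma measurable_hE (d : ℕ) (n c : ℝ) :
    Measurable (fun a : ℝ × EuclideanSpace ℝ (Fin d) => hE d n c a.1 a.2) := by
  unfold hE gg ee
  fun_prop

lemma measurable_PE (d : ℕ) (n c : ℝ) :
    Measurable (fun a : ℝ × EuclideanSpace ℝ (Fin d) => PE d n c a.1 a.2) := by
  unfold PE
  exact Measurable.ite (measurableSet_lt measurable_const measurable_fst) (measurable_hE d n c)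
    measurable_const

lemma hE_mono {d : ℕ} {n c c' r : ℝ} (hr : 0 < r) (h : c ≤ c') (u : EuclideanSpace ℝ (Fin d)) :
    hE d n c' r u ≤ hE d n c r u := by
  unfold hE
  have := gg_mono (D := d) (u := ‖u‖) hr h
  exact ENNReal.ofReal_le_ofReal (by linarith)

lemma PE_mono {d : ℕ} {n c c' r : ℝ} (h : c ≤ c') (u : EuclideanSpace ℝ (Fin d)) :
    PE d n c' r u ≤ PE d n c r u := by
  unfold PE
  split_ifs with hr
  · exact hE_mono hr h u
  · exact le_rfl

lemma lint_gg (d : ℕ) {c r : ℝ} (hc : 0 < c) (hr : 0 < r) :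
    ∫⁻ u : EuclideanSpace ℝ (Fin d), ENNReal.ofReal (gg d c r ‖u‖)
      = ENNReal.ofReal ((Real.pi / c) ^ ((d : ℝ) / 2)) := by
  have hb : 0 < c / r := by positivity
  have h1 := GaussianFourier.integral_rexp_neg_mul_sq_norm (V := EuclideanSpace ℝ (Fin d)) hb
  have h2 : Integrable (fun v : EuclideanSpace ℝ (Fin d) => Real.exp (-(c / r) * ‖v‖ ^ 2)) := by
    by_contra h
    rw [integral_undef h] at h1
    have : 0 < (Real.pi / (c / r)) ^ ((Module.finrank ℝ (EuclideanSpace ℝ (Fin d)) : ℝ) / 2) := by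
      positivity
    linarith
  have h3 : (fun u : EuclideanSpace ℝ (Fin d) => gg d c r ‖u‖) =
      fun u => r ^ (-(d : ℝ) / 2) * Real.exp (-(c / r) * ‖u‖ ^ 2) := by
    funext u
    unfold gg
    congr 2
    ring
  have h4 : ∫ u : EuclideanSpace ℝ (Fin d), gg d c r ‖u‖ = (Real.pi / c) ^ ((d : ℝ) / 2) := by
    rw [h3, integral_const_mul, h1, finrank_euclideanSpace_fin]
    rw [show Real.pi / (c / r) = Real.pi / c * r by field_simp,
      Real.mul_rpow (by positivity) hr.le, neg_div, Real.rpow_neg hr.le]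
    have : 0 < r ^ ((d : ℝ) / 2) := by positivity
    field_simp
  rw [← h4, ofReal_integral_eq_lintegral_ofReal]
  · rw [h3]; exact h2.const_mul _
  · exact Filter.Eventually.of_forall fun u => gg_nonneg _ _ _ hr

lemma lint_ee (d : ℕ) {α r : ℝ} (hα : 0 < α) (hα2 : α < 2) (hr : 0 < r) (hr1 : r ≤ 1) :
    ∫⁻ u : EuclideanSpace ℝ (Fin d), ENNReal.ofReal (ee (d + α) r ‖u‖)
      ≤ ENNReal.ofReal (∫ v : EuclideanSpace ℝ (Fin d), (1 + ‖v‖) ^ (-((d : ℝ) + α))) := by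
  set n := (d : ℝ) + α with hn
  have hs : 0 < √r := by positivity
  have h2 : Integrable (fun v : EuclideanSpace ℝ (Fin d) => (1 + ‖v‖) ^ (-n)) :=
    integrable_one_add_norm (by rw [finrank_euclideanSpace_fin]; linarith)
  have h3 : (fun u : EuclideanSpace ℝ (Fin d) => ee n r ‖u‖) =
      fun u => (r * √r ^ (-n)) * (1 + ‖(√r)⁻¹ • u‖) ^ (-n) := by
    funext u
    unfold ee
    rw [norm_smul, Real.norm_of_nonneg (by positivity), mul_assoc,
      ← Real.mul_rpow (by positivity) (by positivity), mul_add, mul_one, ← mul_assoc,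
      mul_inv_cancel₀ hs.ne', one_mul, Real.rpow_neg (by positivity)]
    rfl
  have h4 : ∫ u : EuclideanSpace ℝ (Fin d), ee n r ‖u‖ ≤
      ∫ v : EuclideanSpace ℝ (Fin d), (1 + ‖v‖) ^ (-n) := by
    rw [h3, integral_const_mul]
    rw [Measure.integral_comp_inv_smul volume (fun v : EuclideanSpace ℝ (Fin d) => (1 + ‖v‖) ^ (-n)),
      finrank_euclideanSpace_fin, abs_of_nonneg (by positivity), smul_eq_mul, ← mul_assoc]
    have hI : 0 ≤ ∫ v : EuclideanSpace ℝ (Fin d), (1 + ‖v‖) ^ (-n) :=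
      integral_nonneg fun v => by positivity
    refine mul_le_of_le_one_left hI ?_
    have e1 : r = √r ^ (2:ℝ) := by rw [Real.rpow_two, Real.sq_sqrt hr.le]
    have e2 : r * √r ^ (-n) * √r ^ d = √r ^ (2 - α) := by
      rw [← Real.rpow_natCast √r d]
      nth_rw 1 [e1]
      rw [← Real.rpow_add hs, ← Real.rpow_add hs]
      congr 1
      rw [hn]; ring
    rw [e2]
    exact Real.rpow_le_one hs.le (Real.sqrt_le_one.2 hr1) (by linarith)
  refine le_trans (le_of_eq ?_) (ENNReal.ofReal_le_ofReal h4)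
  rw [ofReal_integral_eq_lintegral_ofReal]
  · rw [h3]; exact (h2.comp_smul (by positivity)).const_mul _
  · exact Filter.Eventually.of_forall fun u => ee_nonneg _ hr (norm_nonneg _)

lemma exc0 (d : ℕ) {α c : ℝ} (hα : 0 < α) (hα2 : α < 2) (hc : 0 < c) :
    ∃ c0 : ℝ, 0 ≤ c0 ∧ ∀ r, 0 < r → r ≤ 1 → ∫⁻ u, hE d (d + α) c r u ≤ ENNReal.ofReal c0 := by
  have hI : 0 ≤ ∫ v : EuclideanSpace ℝ (Fin d), (1 + ‖v‖) ^ (-((d : ℝ) + α)) :=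
    integral_nonneg fun v => by positivity
  refine ⟨(Real.pi / c) ^ ((d : ℝ) / 2) + ∫ v : EuclideanSpace ℝ (Fin d), (1 + ‖v‖) ^ (-((d : ℝ) + α)),
    by positivity, ?_⟩
  intro r hr hr1
  rw [ENNReal.ofReal_add (by positivity) hI, ← lint_gg d hc hr]
  refine le_trans ?_ (add_le_add_right (lint_ee d hα hα2 hr hr1) _)
  rw [← lintegral_add_left]
  · refine lintegral_mono fun u => ?_
    unfold hE
    exact ENNReal.ofReal_add_le
  · unfold gg; fun_prop

lemma pwE (d : ℕ) {α c : ℝ} (hα : 0 < α) (hα2 : α < 2) (hc : 0 < c) :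
    ∃ K : ℝ, 1 ≤ K ∧ ∀ (r s : ℝ) (x y z w : EuclideanSpace ℝ (Fin d)) (Q A B : ℝ≥0∞),
      0 < r → 0 < s → r + s ≤ 1 → A ≠ ∞ → B ≠ ∞ →
      Q ≤ A * hE d (d + α) (2 * c) s (w - y) + B * eE d (d + α) s (w - y) →
      hE d (d + α) (3 * c) r (x - z) * Q ≤ ENNReal.ofReal K *
        (hE d (d + α) (2 * c) (r + s) (x - y) *
          (Q + A * (hE d (d + α) c r (x - z) + hE d (d + α) c s (w - y))) +
          B * eE d (d + α) (r + s) (x - y) *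
            (hE d (d + α) c r (x - z) + hE d (d + α) c s (w - y))
          + (eE d (d + α) (r + s) (x - y) / ENNReal.ofReal (r + s)) *
            (ENNReal.ofReal (‖z - w‖ ^ ((d : ℝ) + α)) *
            (hE d (d + α) c r (x - z) * (Q + A * hE d (d + α) c s (w - y))))) := by
  obtain ⟨K, hK, h⟩ := pw (D := d) (by positivity) hα hα2 hc
  refine ⟨K, hK, ?_⟩
  intro r s x y z w Q A B hr hs hrs hA hB hQ
  have hQt : Q ≠ ∞ := by
    refine ne_top_of_le_ne_top ?_ hQ
    unfold hE eE
    finiteness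
  obtain ⟨Q, hQ0, rfl⟩ : ∃ q : ℝ, 0 ≤ q ∧ ENNReal.ofReal q = Q :=
    ⟨Q.toReal, ENNReal.toReal_nonneg, ENNReal.ofReal_toReal hQt⟩
  obtain ⟨A, hA0, rfl⟩ : ∃ q : ℝ, 0 ≤ q ∧ ENNReal.ofReal q = A :=
    ⟨A.toReal, ENNReal.toReal_nonneg, ENNReal.ofReal_toReal hA⟩
  obtain ⟨B, hB0, rfl⟩ : ∃ q : ℝ, 0 ≤ q ∧ ENNReal.ofReal q = B :=
    ⟨B.toReal, ENNReal.toReal_nonneg, ENNReal.ofReal_toReal hB⟩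
  have hrs0 : 0 < r + s := by positivity
  have hxle : ‖x - y‖ ≤ ‖x - z‖ + ‖w - y‖ + ‖z - w‖ := by
    have e : x - y = (x - z) + (w - y) + (z - w) := by abel
    rw [e]; exact norm_add₃_le
  have h := h r s ‖x - z‖ ‖w - y‖ ‖x - y‖ ‖z - w‖ Q A B hr hs hrs (norm_nonneg _) (norm_nonneg _)
    (norm_nonneg _) (norm_nonneg _) hxle hQ0 hA0 hB0
  set n := (d : ℝ) + α with hn
  unfold hE eE at *
  have q1 := gg_nonneg d (2 * c) ‖x - y‖ hrs0
  have q2 := ee_nonneg n hrs0 (norm_nonneg (x - y))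
  have q3 := gg_nonneg d c ‖x - z‖ hr
  have q4 := ee_nonneg n hr (norm_nonneg (x - z))
  have q5 := gg_nonneg d c ‖w - y‖ hs
  have q6 := ee_nonneg n hs (norm_nonneg (w - y))
  have q7 := gg_nonneg d (3 * c) ‖x - z‖ hr
  have q8 := gg_nonneg d (2 * c) ‖w - y‖ hs
  rw [← ENNReal.ofReal_mul hA0, ← ENNReal.ofReal_mul hB0, ← ENNReal.ofReal_add (by positivity) (by positivity),
    ENNReal.ofReal_le_ofReal_iff (by positivity)] at hQ
  have h := h hQ
  set g1 := gg d (2 * c) (r + s) ‖x - y‖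
  set g2 := ee n (r + s) ‖x - y‖
  set g3 := gg d c r ‖x - z‖
  set g4 := ee n r ‖x - z‖
  set g5 := gg d c s ‖w - y‖
  set g6 := ee n s ‖w - y‖
  have hz : 0 ≤ ‖z - w‖ ^ n := by positivity
  set hh := ‖z - w‖ ^ n
  rw [← ENNReal.ofReal_mul (by positivity)]
  refine (ENNReal.ofReal_le_ofReal h).trans (le_of_eq ?_)
  rw [← ENNReal.ofReal_div_of_pos hrs0]
  simp only [← ENNReal.ofReal_mul hA0, ← ENNReal.ofReal_mul hB0]
  rw [← ENNReal.ofReal_add (p := g3 + g4) (q := g5 + g6) (by positivity) (by positivity)]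
  rw [← ENNReal.ofReal_mul hA0, ← ENNReal.ofReal_add hQ0 (by positivity),
    ← ENNReal.ofReal_add hQ0 (by positivity), ← ENNReal.ofReal_mul (by positivity),
    ← ENNReal.ofReal_mul (by positivity),
    ← ENNReal.ofReal_mul (by positivity), ← ENNReal.ofReal_mul (by positivity),
    ← ENNReal.ofReal_mul (by positivity),
    ← ENNReal.ofReal_add (by positivity) (by positivity),
    ← ENNReal.ofReal_add (by positivity) (by positivity),
    ← ENNReal.ofReal_mul (by positivity)]
  congr 1
  ring


noncomputable def QQ (d : ℕ) (n c T : ℝ) (CE : ℝ≥0∞)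
    (θ : Measure (EuclideanSpace ℝ (Fin d) × EuclideanSpace ℝ (Fin d)))
    (y : EuclideanSpace ℝ (Fin d)) : ℕ → ℝ → EuclideanSpace ℝ (Fin d) → ℝ≥0∞
  | 0, t, x => CE * PE d n (3 * c) t (x - y)
  | k + 1, t, x => ∫⁻ ω, CE * PE d n (3 * c) (t - ω.1) (x - ω.2.1) *
      QQ d n c T CE θ y k ω.1 ω.2.2 ∂(volume.restrict (Ioc 0 T)).prod θ

section core

variable {d : ℕ} {n c T : ℝ} {CE : ℝ≥0∞}
    {θ : Measure (EuclideanSpace ℝ (Fin d) × EuclideanSpace ℝ (Fin d))}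
    {y : EuclideanSpace ℝ (Fin d)}

lemma measurable_QQ [SFinite θ] (k : ℕ) :
    Measurable (fun a : ℝ × EuclideanSpace ℝ (Fin d) => QQ d n c T CE θ y k a.1 a.2) := by
  have hP := measurable_PE d n (3 * c)
  induction k with
  | zero =>
    simp only [QQ]
    exact (hP.comp (by fun_prop : Measurable fun a : ℝ × EuclideanSpace ℝ (Fin d) =>
      (a.1, a.2 - y))).const_mul _
  | succ k ih =>
    simp only [QQ]
    refine Measurable.lintegral_prod_right' (f := fun b : (ℝ × EuclideanSpace ℝ (Fin d)) ×
      (ℝ × EuclideanSpace ℝ (Fin d) × EuclideanSpace ℝ (Fin d)) =>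
      CE * PE d n (3 * c) (b.1.1 - b.2.1) (b.1.2 - b.2.2.1) * QQ d n c T CE θ y k b.2.1 b.2.2.2) ?_
    refine ((hP.comp (by fun_prop : Measurable fun b : (ℝ × EuclideanSpace ℝ (Fin d)) ×
      (ℝ × EuclideanSpace ℝ (Fin d) × EuclideanSpace ℝ (Fin d)) =>
      (b.1.1 - b.2.1, b.1.2 - b.2.2.1))).const_mul _).mul ?_
    exact ih.comp (by fun_prop : Measurable fun b : (ℝ × EuclideanSpace ℝ (Fin d)) ×
      (ℝ × EuclideanSpace ℝ (Fin d) × EuclideanSpace ℝ (Fin d)) => (b.2.1, b.2.2.2))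

lemma ae_s (θ : Measure (EuclideanSpace ℝ (Fin d) × EuclideanSpace ℝ (Fin d))) [SFinite θ] (T : ℝ) :
    ∀ᵐ ω ∂((volume.restrict (Ioc (0:ℝ) T)).prod θ), ω.1 ∈ Ioc (0:ℝ) T := by
  have h : ∀ᵐ s ∂(volume.restrict (Ioc (0:ℝ) T)), s ∈ Ioc (0:ℝ) T :=
    ae_restrict_mem measurableSet_Ioc
  exact Measure.quasiMeasurePreserving_fst.ae h

/-- shift forward -/
lemma shift1 {s T : ℝ} (hs : 0 ≤ s) (F : ℝ → ℝ≥0∞) :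
    ∫⁻ t in Ioc 0 T, (if 0 < t - s then F (t - s) else 0) ≤ ∫⁻ t in Ioc 0 T, F t := by
  rw [← lintegral_indicator measurableSet_Ioc, ← lintegral_indicator measurableSet_Ioc,
    ← lintegral_sub_right_eq_self ((Ioc 0 T).indicator F) s]
  refine lintegral_mono fun t => ?_
  simp only [indicator]
  split_ifs with h1 h2 h3 h3
  · exact le_rfl
  · exact absurd ⟨h2, by linarith [h1.2]⟩ h3
  all_goals exact zero_le

/-- shift backward -/
lemma shift2 {t T : ℝ} (ht : t ≤ T) (F : ℝ → ℝ≥0∞) :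
    ∫⁻ s in Ioc 0 T, (if 0 < t - s then F (t - s) else 0) ≤ ∫⁻ t in Ioc 0 T, F t := by
  rw [← lintegral_indicator measurableSet_Ioc, ← lintegral_indicator measurableSet_Ioc,
    ← lintegral_sub_left_eq_self ((Ioc 0 T).indicator F) t]
  refine lintegral_mono fun s => ?_
  simp only [indicator]
  split_ifs with h1 h2 h3 h3
  · exact le_rfl
  · exact absurd ⟨h2, by linarith [h1.1]⟩ h3
  all_goals exact zero_le

lemma prodP1 [SFinite θ] {N : ℝ≥0∞}
    (h2 : ∀ y, ∫⁻ s in Ioc 0 T, ∫⁻ zw, hE d n c s (zw.2 - y) ∂θ ≤ N) {s : ℝ} (hs : 0 ≤ s)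
    (z : EuclideanSpace ℝ (Fin d)) :
    ∫⁻ ω, PE d n c (ω.1 - s) (ω.2.2 - z) ∂(volume.restrict (Ioc 0 T)).prod θ ≤ N := by
  rw [lintegral_prod]
  · refine le_trans (le_trans (le_of_eq ?_) (shift1 hs _)) (h2 z)
    congr 1
    funext t
    unfold PE
    split_ifs <;> simp
  · exact ((measurable_PE d n c).comp (by fun_prop : Measurable fun ω : ℝ × EuclideanSpace ℝ (Fin d) ×
      EuclideanSpace ℝ (Fin d) => (ω.1 - s, ω.2.2 - z))).aemeasurable

lemma prodP2 [SFinite θ] {N : ℝ≥0∞}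
    (h1 : ∀ x, ∫⁻ s in Ioc 0 T, ∫⁻ zw, hE d n c s (x - zw.1) ∂θ ≤ N) {t : ℝ} (ht : t ≤ T)
    (x : EuclideanSpace ℝ (Fin d)) :
    ∫⁻ ω, PE d n c (t - ω.1) (x - ω.2.1) ∂(volume.restrict (Ioc 0 T)).prod θ ≤ N := by
  rw [lintegral_prod]
  · refine le_trans (le_trans (le_of_eq ?_) (shift2 ht _)) (h1 x)
    congr 1
    funext t
    unfold PE
    split_ifs <;> simp
  · exact ((measurable_PE d n c).comp (by fun_prop : Measurable fun ω : ℝ × EuclideanSpace ℝ (Fin d) ×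
      EuclideanSpace ℝ (Fin d) => (t - ω.1, x - ω.2.1))).aemeasurable

lemma hE_le_PE {s : ℝ} (hs : 0 < s) (u : EuclideanSpace ℝ (Fin d)) : PE d n c s u = hE d n c s u := by
  unfold PE; rw [if_pos hs]

lemma Abound [SFinite θ] {N : ℝ≥0∞} (hc : 0 < c)
    (h2 : ∀ y, ∫⁻ s in Ioc 0 T, ∫⁻ zw, hE d n c s (zw.2 - y) ∂θ ≤ N) (k : ℕ) :
    ∫⁻ ω, QQ d n c T CE θ y k ω.1 ω.2.2 ∂(volume.restrict (Ioc 0 T)).prod θ ≤ (CE * N) ^ (k + 1) := by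
  have hP := measurable_PE d n (3 * c)
  induction k with
  | zero =>
    simp only [QQ, zero_add, pow_one]
    rw [lintegral_const_mul]
    · gcongr
      refine le_trans (lintegral_mono fun ω => PE_mono (by linarith : c ≤ 3 * c) _) ?_
      simpa using prodP1 h2 le_rfl y
    · exact (hP.comp (by fun_prop : Measurable fun ω : ℝ × EuclideanSpace ℝ (Fin d) ×
        EuclideanSpace ℝ (Fin d) => (ω.1, ω.2.2 - y)))
  | succ k ih =>
    simp only [QQ]
    have hQ := measurable_QQ (d := d) (n := n) (c := c) (T := T) (CE := CE) (θ := θ) (y := y) k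
    rw [lintegral_lintegral_swap]
    · calc _ ≤ ∫⁻ ω, (CE * N) * QQ d n c T CE θ y k ω.1 ω.2.2 ∂(volume.restrict (Ioc 0 T)).prod θ := by
            refine lintegral_mono_ae ?_
            filter_upwards [ae_s θ T] with ω hω
            have m : Measurable fun a : ℝ × EuclideanSpace ℝ (Fin d) × EuclideanSpace ℝ (Fin d) =>
                PE d n (3 * c) (a.1 - ω.1) (a.2.2 - ω.2.1) :=
              hP.comp (by fun_prop : Measurable fun a : ℝ × EuclideanSpace ℝ (Fin d) ×
                EuclideanSpace ℝ (Fin d) => (a.1 - ω.1, a.2.2 - ω.2.1))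
            rw [lintegral_mul_const _ (m.const_mul _), lintegral_const_mul _ m]
            gcongr
            refine le_trans (lintegral_mono fun ω => PE_mono (by linarith : c ≤ 3 * c) _) ?_
            exact prodP1 h2 hω.1.le _
        _ = (CE * N) * ∫⁻ ω, QQ d n c T CE θ y k ω.1 ω.2.2 ∂(volume.restrict (Ioc 0 T)).prod θ := by
            rw [lintegral_const_mul]
            exact hQ.comp (by fun_prop : Measurable fun ω : ℝ × EuclideanSpace ℝ (Fin d) ×
              EuclideanSpace ℝ (Fin d) => (ω.1, ω.2.2))
        _ ≤ (CE * N) * (CE * N) ^ (k + 1) := by gcongr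
        _ = _ := by rw [pow_succ' _ (k + 1)]
    · refine Measurable.aemeasurable ?_
      refine Measurable.mul (f := fun b : (ℝ × EuclideanSpace ℝ (Fin d) × EuclideanSpace ℝ (Fin d)) ×
        (ℝ × EuclideanSpace ℝ (Fin d) × EuclideanSpace ℝ (Fin d)) =>
          CE * PE d n (3 * c) (b.1.1 - b.2.1) (b.1.2.2 - b.2.2.1)) ?_ ?_
      · exact (hP.comp (by fun_prop : Measurable fun b : (ℝ × EuclideanSpace ℝ (Fin d) × EuclideanSpace ℝ (Fin d)) ×
          (ℝ × EuclideanSpace ℝ (Fin d) × EuclideanSpace ℝ (Fin d)) =>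
          (b.1.1 - b.2.1, b.1.2.2 - b.2.2.1))).const_mul _
      · exact hQ.comp (by fun_prop : Measurable fun b : (ℝ × EuclideanSpace ℝ (Fin d) × EuclideanSpace ℝ (Fin d)) ×
          (ℝ × EuclideanSpace ℝ (Fin d) × EuclideanSpace ℝ (Fin d)) => (b.2.1, b.2.2.2))

lemma intPE {c0 : ℝ≥0∞} (hc0 : ∀ r, 0 < r → r ≤ 1 → ∫⁻ u, hE d n c r u ≤ c0) {r : ℝ} (hr : r ≤ 1) :
    ∫⁻ u, PE d n c r u ≤ c0 := by
  unfold PE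
  split_ifs with h
  · exact hc0 r h hr
  · simp

lemma Dbound [SFinite θ] {N c0 : ℝ≥0∞} (hc : 0 < c) (hT : T ≤ 1)
    (hc0 : ∀ r, 0 < r → r ≤ 1 → ∫⁻ u, hE d n c r u ≤ c0)
    (h2 : ∀ y, ∫⁻ s in Ioc 0 T, ∫⁻ zw, hE d n c s (zw.2 - y) ∂θ ≤ N) (k : ℕ) {t : ℝ} (ht : t ≤ T) :
    ∫⁻ x, QQ d n c T CE θ y k t x ≤ CE * c0 * (CE * N) ^ k := by
  have hP := measurable_PE d n (3 * c)
  have key : ∀ r z, r ≤ 1 → ∫⁻ x : EuclideanSpace ℝ (Fin d), PE d n (3 * c) r (x - z) ≤ c0 := by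
    intro r z hr
    rw [lintegral_sub_right_eq_self (fun x => PE d n (3 * c) r x) z]
    exact le_trans (lintegral_mono fun ω => PE_mono (by linarith : c ≤ 3 * c) _) (intPE hc0 hr)
  have mm : ∀ r z, Measurable fun x : EuclideanSpace ℝ (Fin d) => PE d n (3 * c) r (x - z) :=
    fun r z => hP.comp (by fun_prop : Measurable fun x : EuclideanSpace ℝ (Fin d) => (r, x - z))
  cases k with
  | zero =>
    simp only [QQ, pow_zero, mul_one]
    rw [lintegral_const_mul _ (mm t y)]
    gcongr
    exact key t y (ht.trans hT)
  | succ k =>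
    simp only [QQ]
    have hQ := measurable_QQ (d := d) (n := n) (c := c) (T := T) (CE := CE) (θ := θ) (y := y) k
    rw [lintegral_lintegral_swap]
    · calc _ ≤ ∫⁻ ω, (CE * c0) * QQ d n c T CE θ y k ω.1 ω.2.2 ∂(volume.restrict (Ioc 0 T)).prod θ := by
            refine lintegral_mono_ae ?_
            filter_upwards [ae_s θ T] with ω hω
            rw [lintegral_mul_const _ ((mm _ _).const_mul _), lintegral_const_mul _ (mm _ _)]
            gcongr
            exact key _ _ (by linarith [hω.1])
        _ = (CE * c0) * ∫⁻ ω, QQ d n c T CE θ y k ω.1 ω.2.2 ∂(volume.restrict (Ioc 0 T)).prod θ := by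
            rw [lintegral_const_mul]
            exact hQ.comp (by fun_prop : Measurable fun ω : ℝ × EuclideanSpace ℝ (Fin d) ×
              EuclideanSpace ℝ (Fin d) => (ω.1, ω.2.2))
        _ ≤ _ := by
            gcongr
            exact Abound hc h2 k
    · refine Measurable.aemeasurable ?_
      refine Measurable.mul (f := fun b : EuclideanSpace ℝ (Fin d) ×
        (ℝ × EuclideanSpace ℝ (Fin d) × EuclideanSpace ℝ (Fin d)) =>
          CE * PE d n (3 * c) (t - b.2.1) (b.1 - b.2.2.1)) ?_ ?_
      · exact (hP.comp (by fun_prop : Measurable fun b : EuclideanSpace ℝ (Fin d) ×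
          (ℝ × EuclideanSpace ℝ (Fin d) × EuclideanSpace ℝ (Fin d)) =>
          (t - b.2.1, b.1 - b.2.2.1))).const_mul _
      · exact hQ.comp (by fun_prop : Measurable fun b : EuclideanSpace ℝ (Fin d) ×
          (ℝ × EuclideanSpace ℝ (Fin d) × EuclideanSpace ℝ (Fin d)) => (b.2.1, b.2.2.2))

/-- the jump remainder -/
lemma Jbound [SFinite θ] {N c0 L A : ℝ≥0∞} (hc : 0 < c) (hT : T ≤ 1)
    (hc0 : ∀ r, 0 < r → r ≤ 1 → ∫⁻ u, hE d n c r u ≤ c0)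
    (h2 : ∀ y, ∫⁻ s in Ioc 0 T, ∫⁻ zw, hE d n c s (zw.2 - y) ∂θ ≤ N)
    (h3 : ∀ f : EuclideanSpace ℝ (Fin d) × EuclideanSpace ℝ (Fin d) → ℝ≥0∞, Measurable f →
      ∫⁻ zw, ENNReal.ofReal (‖zw.1 - zw.2‖ ^ n) * f zw ∂θ ≤ L * ∫⁻ zw, f zw)
    (k : ℕ) {t : ℝ} (ht0 : 0 < t) (ht : t ≤ T) (x : EuclideanSpace ℝ (Fin d)) :
    ∫⁻ ω, ENNReal.ofReal (‖ω.2.1 - ω.2.2‖ ^ n) * (PE d n c (t - ω.1) (x - ω.2.1) *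
      (QQ d n c T CE θ y k ω.1 ω.2.2 + A * hE d n c ω.1 (ω.2.2 - y)))
      ∂(volume.restrict (Ioc 0 T)).prod θ ≤
      ENNReal.ofReal t * (L * (c0 * (CE * c0 * (CE * N) ^ k + A * c0))) := by
  have hP := measurable_PE d n c
  have hH := measurable_hE d n c
  have hQ := measurable_QQ (d := d) (n := n) (c := c) (T := T) (CE := CE) (θ := θ) (y := y) k
  have m1 : Measurable fun ω : ℝ × EuclideanSpace ℝ (Fin d) × EuclideanSpace ℝ (Fin d) =>
      PE d n c (t - ω.1) (x - ω.2.1) :=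
    hP.comp (by fun_prop : Measurable fun ω : ℝ × EuclideanSpace ℝ (Fin d) ×
      EuclideanSpace ℝ (Fin d) => (t - ω.1, x - ω.2.1))
  have m2 : Measurable fun a : ℝ × EuclideanSpace ℝ (Fin d) =>
      QQ d n c T CE θ y k a.1 a.2 + A * hE d n c a.1 (a.2 - y) :=
    hQ.add ((hH.comp (by fun_prop : Measurable fun a : ℝ × EuclideanSpace ℝ (Fin d)
       => (a.1, a.2 - y))).const_mul _)
  have m2' : Measurable fun ω : ℝ × EuclideanSpace ℝ (Fin d) × EuclideanSpace ℝ (Fin d) =>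
      QQ d n c T CE θ y k ω.1 ω.2.2 + A * hE d n c ω.1 (ω.2.2 - y) :=
    m2.comp (by fun_prop : Measurable fun ω : ℝ × EuclideanSpace ℝ (Fin d) ×
      EuclideanSpace ℝ (Fin d) => (ω.1, ω.2.2))
  rw [lintegral_prod]
  · have hb : ∀ s ∈ Ioc (0:ℝ) T, ∫⁻ zw : EuclideanSpace ℝ (Fin d) × EuclideanSpace ℝ (Fin d),
        ENNReal.ofReal (‖zw.1 - zw.2‖ ^ n) * (PE d n c (t - s) (x - zw.1) *
        (QQ d n c T CE θ y k s zw.2 + A * hE d n c s (zw.2 - y))) ∂θ ≤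
        (Ioc 0 t).indicator (fun _ => L * (c0 * (CE * c0 * (CE * N) ^ k + A * c0))) s := by
      intro s hs
      by_cases hst : s ∈ Ioc 0 t
      · rw [indicator_of_mem hst]
        refine (h3 (fun zw => PE d n c (t - s) (x - zw.1) *
          (QQ d n c T CE θ y k s zw.2 + A * hE d n c s (zw.2 - y))) ?_).trans ?_
        · exact (m1.mul m2').comp (measurable_const.prodMk measurable_id : Measurable fun
            zw : EuclideanSpace ℝ (Fin d) × EuclideanSpace ℝ (Fin d) => (s, zw))
        · gcongr
          have a1 : Measurable fun z : EuclideanSpace ℝ (Fin d) => PE d n c (t - s) (x - z) :=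
            hP.comp (by fun_prop : Measurable fun z : EuclideanSpace ℝ (Fin d) => (t - s, x - z))
          have a2 : Measurable fun w : EuclideanSpace ℝ (Fin d) =>
              QQ d n c T CE θ y k s w + A * hE d n c s (w - y) :=
            m2.comp (by fun_prop : Measurable fun w : EuclideanSpace ℝ (Fin d) => (s, w))
          have a3 : Measurable fun w : EuclideanSpace ℝ (Fin d) => hE d n c s (w - y) :=
            hH.comp (by fun_prop : Measurable fun w : EuclideanSpace ℝ (Fin d) => (s, w - y))
          have a4 : Measurable fun w : EuclideanSpace ℝ (Fin d) => QQ d n c T CE θ y k s w :=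
            hQ.comp (by fun_prop : Measurable fun w : EuclideanSpace ℝ (Fin d) => (s, w))
          rw [Measure.volume_eq_prod, lintegral_prod_mul a1.aemeasurable a2.aemeasurable]
          gcongr
          · rw [lintegral_sub_left_eq_self (fun z => PE d n c (t - s) z) x]
            exact intPE hc0 (by linarith [hs.1])
          · rw [lintegral_add_left a4, lintegral_const_mul _ a3]
            gcongr
            · exact Dbound hc hT hc0 h2 k hs.2
            · rw [lintegral_sub_right_eq_self (fun w => hE d n c s w) y]
              exact hc0 s hs.1 (hs.2.trans hT)
      · rw [indicator_of_notMem hst]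
        have : ¬ (0 < t - s) := fun h => hst ⟨hs.1, by linarith⟩
        simp [PE, this]
    refine (setLIntegral_mono' measurableSet_Ioc hb).trans ?_
    refine (setLIntegral_le_lintegral _ _).trans ?_
    rw [lintegral_indicator measurableSet_Ioc, setLIntegral_const, Real.volume_Ioc, sub_zero, mul_comm]
  · exact (Measurable.mul (by fun_prop) (m1.mul m2')).aemeasurable

end core


lemma step_alg {K CE l c0 Lam B N0 M p e Ak Dk : ℝ≥0∞} {k : ℕ}
    (hM : M = 4 * K * CE * l + 2 * K * Lam * CE * c0 ^ 2) (hK : 1 ≤ K) 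
    (hA : Ak ≤ (CE * (l * N0)) ^ (k + 1)) (hD : Dk ≤ CE * c0 * (CE * (l * N0)) ^ k) :
    CE * (K * (p * (Ak + CE * (M * N0) ^ k * (l * N0 + l * N0)) +
      CE * (k * B * M * (M * N0) ^ (k - 1)) * e * (l * N0 + l * N0) +
      e * (Lam * B * (c0 * (Dk + CE * (M * N0) ^ k * c0))))) ≤
    CE * (M * N0) ^ (k + 1) * p + CE * (((k + 1 : ℕ) : ℝ≥0∞) * B * M * (M * N0) ^ k) * e := by
  have hCl : CE * l ≤ M := by
    calc CE * l = 1 * 1 * (CE * l) := by ring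
      _ ≤ 4 * K * (CE * l) := by gcongr; norm_num
      _ ≤ M := by rw [hM, ← mul_assoc]; exact le_self_add
  have hX : CE * (l * N0) ≤ M * N0 := by rw [← mul_assoc]; gcongr
  have e1 : Ak ≤ CE * (l * N0) * (M * N0) ^ k := by
    refine hA.trans ?_
    rw [pow_succ']; gcongr
  have e2 : Dk ≤ CE * c0 * (M * N0) ^ k := hD.trans (by gcongr)
  have e3 : CE * (k * B * M * (M * N0) ^ (k - 1)) * e * (l * N0 + l * N0) =
      2 * CE * l * (k * B * (M * N0) ^ k) * e := by
    cases k with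
    | zero => simp
    | succ k =>
      simp only [Nat.add_sub_cancel]
      ring
  have e4 : K * (Ak + CE * (M * N0) ^ k * (l * N0 + l * N0)) ≤ (M * N0) ^ (k + 1) := by
    calc _ ≤ K * (CE * (l * N0) * (M * N0) ^ k + CE * (M * N0) ^ k * (l * N0 + l * N0)) := by gcongr
      _ = (3 * K * CE * l) * N0 * (M * N0) ^ k := by ring
      _ ≤ M * N0 * (M * N0) ^ k := by
          gcongr
          rw [hM]
          refine le_trans ?_ le_self_add
          gcongr; norm_num
      _ = _ := by ring
  have e5 : K * (2 * CE * l * (k * B * (M * N0) ^ k) +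
      Lam * B * (c0 * (Dk + CE * (M * N0) ^ k * c0))) ≤
      ((k + 1 : ℕ) : ℝ≥0∞) * B * M * (M * N0) ^ k := by
    calc _ ≤ K * (2 * CE * l * (k * B * (M * N0) ^ k) +
          Lam * B * (c0 * (CE * c0 * (M * N0) ^ k + CE * (M * N0) ^ k * c0))) := by gcongr
      _ = k * (2 * K * CE * l) * (B * (M * N0) ^ k) +
          (2 * K * Lam * CE * c0 ^ 2) * (B * (M * N0) ^ k) := by ring
      _ ≤ k * M * (B * (M * N0) ^ k) + M * (B * (M * N0) ^ k) := by
          gcongr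
          · rw [hM]
            refine le_trans ?_ le_self_add
            gcongr; norm_num
          · rw [hM]; exact le_add_self
      _ = _ := by push_cast; ring
  rw [e3]
  calc _ = CE * (K * (Ak + CE * (M * N0) ^ k * (l * N0 + l * N0))) * p +
      CE * (K * (2 * CE * l * (k * B * (M * N0) ^ k) +
      Lam * B * (c0 * (Dk + CE * (M * N0) ^ k * c0)))) * e := by ring
    _ ≤ _ := by gcongr

lemma core_ind {d : ℕ} {α c T K : ℝ} {CE c0 Lam B l N0 M : ℝ≥0∞}
    {θ : Measure (EuclideanSpace ℝ (Fin d) × EuclideanSpace ℝ (Fin d))}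
    {y : EuclideanSpace ℝ (Fin d)} [SFinite θ] (hc : 0 < c) (hT : T ≤ 1)
    (hK1 : 1 ≤ K)
    (hK : ∀ (r s : ℝ) (x y z w : EuclideanSpace ℝ (Fin d)) (Q A B : ℝ≥0∞),
      0 < r → 0 < s → r + s ≤ 1 → A ≠ ∞ → B ≠ ∞ →
      Q ≤ A * hE d (d + α) (2 * c) s (w - y) + B * eE d (d + α) s (w - y) →
      hE d (d + α) (3 * c) r (x - z) * Q ≤ ENNReal.ofReal K *
        (hE d (d + α) (2 * c) (r + s) (x - y) *
          (Q + A * (hE d (d + α) c r (x - z) + hE d (d + α) c s (w - y))) +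
          B * eE d (d + α) (r + s) (x - y) *
            (hE d (d + α) c r (x - z) + hE d (d + α) c s (w - y))
          + (eE d (d + α) (r + s) (x - y) / ENNReal.ofReal (r + s)) *
            (ENNReal.ofReal (‖z - w‖ ^ ((d : ℝ) + α)) *
            (hE d (d + α) c r (x - z) * (Q + A * hE d (d + α) c s (w - y))))))
    (hc0 : ∀ r, 0 < r → r ≤ 1 → ∫⁻ u, hE d (d + α) c r u ≤ c0)
    (h1 : ∀ x, ∫⁻ s in Ioc 0 T, ∫⁻ zw, hE d (d + α) c s (x - zw.1) ∂θ ≤ l * N0)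
    (h2 : ∀ y, ∫⁻ s in Ioc 0 T, ∫⁻ zw, hE d (d + α) c s (zw.2 - y) ∂θ ≤ l * N0)
    (h3 : ∀ f : EuclideanSpace ℝ (Fin d) × EuclideanSpace ℝ (Fin d) → ℝ≥0∞, Measurable f →
      ∫⁻ zw, ENNReal.ofReal (‖zw.1 - zw.2‖ ^ ((d : ℝ) + α)) * f zw ∂θ ≤ (Lam * B) * ∫⁻ zw, f zw)
    (hCE : CE ≠ ∞) (hMt : M ≠ ∞) (hN0 : N0 ≠ ∞) (hB : B ≠ ∞)
    (hM : M = 4 * ENNReal.ofReal K * CE * l + 2 * ENNReal.ofReal K * Lam * CE * c0 ^ 2) (k : ℕ) :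
    ∀ t ∈ Ioc 0 T, ∀ x, QQ d (d + α) c T CE θ y k t x ≤
      CE * (M * N0) ^ k * hE d (d + α) (2 * c) t (x - y) +
      CE * (k * B * M * (M * N0) ^ (k - 1)) * eE d (d + α) t (x - y) := by
  set n := (d : ℝ) + α with hn
  induction k with
  | zero =>
    intro t ht x
    simp only [QQ]
    rw [hE_le_PE ht.1]
    simp only [pow_zero, mul_one, Nat.cast_zero, zero_mul, mul_zero, add_zero]
    gcongr
    exact hE_mono ht.1 (by linarith) _
  | succ k ih =>
    intro t ht x
    set A := CE * (M * N0) ^ k with hA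
    set Bk := CE * (k * B * M * (M * N0) ^ (k - 1)) with hBk
    have hAt : A ≠ ∞ := by rw [hA]; finiteness
    have hBt : Bk ≠ ∞ := by rw [hBk]; finiteness
    set p := hE d n (2 * c) t (x - y) with hp
    set e := eE d n t (x - y) with he
    set KE := ENNReal.ofReal K with hKE
    have hKE1 : 1 ≤ KE := by rw [hKE]; simpa using hK1
    set ν := (volume.restrict (Ioc 0 T)).prod θ with hν
    set Q : ℝ × EuclideanSpace ℝ (Fin d) × EuclideanSpace ℝ (Fin d) → ℝ≥0∞ :=
      fun ω => QQ d n c T CE θ y k ω.1 ω.2.2 with hQ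
    set P : ℝ × EuclideanSpace ℝ (Fin d) × EuclideanSpace ℝ (Fin d) → ℝ≥0∞ :=
      fun ω => PE d n c (t - ω.1) (x - ω.2.1) with hPd
    set H : ℝ × EuclideanSpace ℝ (Fin d) × EuclideanSpace ℝ (Fin d) → ℝ≥0∞ :=
      fun ω => hE d n c ω.1 (ω.2.2 - y) with hHd
    set R : ℝ × EuclideanSpace ℝ (Fin d) × EuclideanSpace ℝ (Fin d) → ℝ≥0∞ :=
      fun ω => ENNReal.ofReal (‖ω.2.1 - ω.2.2‖ ^ n) * (P ω * (Q ω + A * H ω)) with hR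
    have mQ : Measurable Q := (measurable_QQ k).comp (by fun_prop :
      Measurable fun ω : ℝ × EuclideanSpace ℝ (Fin d) × EuclideanSpace ℝ (Fin d) => (ω.1, ω.2.2))
    have mP : Measurable P := (measurable_PE d n c).comp (by fun_prop :
      Measurable fun ω : ℝ × EuclideanSpace ℝ (Fin d) × EuclideanSpace ℝ (Fin d) =>
        (t - ω.1, x - ω.2.1))
    have mH : Measurable H := (measurable_hE d n c).comp (by fun_prop :
      Measurable fun ω : ℝ × EuclideanSpace ℝ (Fin d) × EuclideanSpace ℝ (Fin d) =>
        (ω.1, ω.2.2 - y))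
    have iQ : ∫⁻ ω, Q ω ∂ν ≤ (CE * (l * N0)) ^ (k + 1) := Abound hc h2 k
    have iP : ∫⁻ ω, P ω ∂ν ≤ l * N0 := prodP2 h1 ht.2 x
    have iH : ∫⁻ ω, H ω ∂ν ≤ l * N0 := by
      rw [hν, lintegral_prod _ mH.aemeasurable]
      exact h2 y
    have iR : ∫⁻ ω, R ω ∂ν ≤ ENNReal.ofReal t *
        ((Lam * B) * (c0 * (CE * c0 * (CE * (l * N0)) ^ k + A * c0))) :=
      Jbound hc hT hc0 h2 h3 k ht.1 ht.2 x
    have hpt : ∀ᵐ ω ∂ν, CE * PE d n (3 * c) (t - ω.1) (x - ω.2.1) * Q ω ≤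
        CE * (KE * (p * (Q ω + A * (P ω + H ω)) + Bk * e * (P ω + H ω) +
          e / ENNReal.ofReal t * R ω)) := by
      filter_upwards [ae_s θ T] with ω hω
      rw [mul_assoc]
      refine mul_le_mul' le_rfl ?_
      by_cases hst : 0 < t - ω.1
      · have := hK (t - ω.1) ω.1 x y ω.2.1 ω.2.2 (Q ω) A Bk hst hω.1 (by linarith [ht.2]) hAt hBt
          (ih ω.1 hω ω.2.2)
        rw [sub_add_cancel] at this
        simp only [hR, hPd, hE_le_PE hst]
        exact this
      · simp [PE, hst]
    simp only [QQ]
    refine (lintegral_mono_ae hpt).trans ?_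
    have mR : Measurable R := Measurable.mul (by fun_prop) (mP.mul (mQ.add (mH.const_mul _)))
    rw [lintegral_const_mul _ (by fun_prop), lintegral_const_mul _ (by fun_prop),
      lintegral_add_left (by fun_prop), lintegral_add_left (by fun_prop),
      lintegral_const_mul _ (by fun_prop), lintegral_const_mul _ (by fun_prop),
      lintegral_const_mul _ (by fun_prop), lintegral_add_left (by fun_prop),
      lintegral_const_mul _ (by fun_prop), lintegral_add_left (by fun_prop)]
    have ht' : ENNReal.ofReal t ≠ 0 := by simpa using ht.1
    have jj : e / ENNReal.ofReal t * ∫⁻ ω, R ω ∂ν ≤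
        e * ((Lam * B) * (c0 * (CE * c0 * (CE * (l * N0)) ^ k + A * c0))) := by
      calc _ ≤ e / ENNReal.ofReal t * (ENNReal.ofReal t *
          ((Lam * B) * (c0 * (CE * c0 * (CE * (l * N0)) ^ k + A * c0)))) := by gcongr
        _ = _ := by rw [← mul_assoc, ENNReal.div_mul_cancel ht' ENNReal.ofReal_ne_top]
    refine le_trans ?_ (step_alg (k := k) (B := B) (p := p) (e := e) (c0 := c0) (N0 := N0) hM hKE1 le_rfl le_rfl)
    gcongr

lemma hE_eq (d : ℕ) (α c r : ℝ) (u : EuclideanSpace ℝ (Fin d)) :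
    hE d (d + α) c r u = ENNReal.ofReal (Gam d c r u + eta d α r u) := by
  unfold hE Gam eta gg ee
  rw [Real.sqrt_eq_rpow]

lemma hE_pos {d : ℕ} {n c r : ℝ} (hr : 0 < r) (u : EuclideanSpace ℝ (Fin d)) :
    hE d n c r u ≠ 0 := by
  unfold hE
  have h1 : 0 < gg d c r ‖u‖ := by unfold gg; positivity
  have := ee_nonneg n hr (norm_nonneg u)
  simp only [ne_eq, ENNReal.ofReal_eq_zero, not_le]
  positivity

lemma eE_le_hE {d : ℕ} {n c r : ℝ} (hr : 0 < r) (u : EuclideanSpace ℝ (Fin d)) :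
    eE d n r u ≤ hE d n c r u := by
  unfold hE eE
  have := gg_nonneg d c ‖u‖ hr
  exact ENNReal.ofReal_le_ofReal (by linarith)

lemma hE_neg {d : ℕ} (n c r : ℝ) (u v : EuclideanSpace ℝ (Fin d)) :
    hE d n c r (u - v) = hE d n c r (v - u) := by
  unfold hE; rw [norm_sub_rev]

lemma sfin_of_N {d : ℕ} {α c T : ℝ} (hT : 0 < T) (μ : Measure (EuclideanSpace ℝ (Fin d)))
    (h : Nmu d α c μ T ≠ ∞) : SFinite μ := by
  have h0 : ∫⁻ s in Ioc (0:ℝ) T, ∫⁻ y, hE d (d + α) c s (0 - y) ∂μ ≠ ∞ := by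
    refine ne_top_of_le_ne_top h ?_
    simp only [hE_eq]
    exact le_iSup (fun x : EuclideanSpace ℝ (Fin d) => ∫⁻ s in Ioc (0 : ℝ) T, ∫⁻ y,
      ENNReal.ofReal (Gam d c s (x - y) + eta d α s (x - y)) ∂μ) 0
  obtain ⟨s, hs, hfin⟩ : ∃ s ∈ Ioc (0:ℝ) T, ∫⁻ y, hE d (d + α) c s (0 - y) ∂μ ≠ ∞ := by
    by_contra hcon
    push Not at hcon
    apply h0
    rw [setLIntegral_congr_fun measurableSet_Ioc (g := fun _ => ∞) (fun s hs => hcon s hs),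
      setLIntegral_const, Real.volume_Ioc, sub_zero, ENNReal.top_mul]
    simpa using hT
  have m : Measurable fun y : EuclideanSpace ℝ (Fin d) => hE d (d + α) c s (0 - y) :=
    (measurable_hE d (d + α) c).comp
      (by fun_prop : Measurable fun y : EuclideanSpace ℝ (Fin d) => (s, 0 - y))
  have : IsFiniteMeasure (μ.withDensity fun y => hE d (d + α) c s (0 - y)) :=
    isFiniteMeasure_withDensity hfin
  have e := withDensity_inv_same (μ := μ) m (Filter.Eventually.of_forall fun y => hE_pos hs.1 _)
    (Filter.Eventually.of_forall fun y => by unfold hE; exact ENNReal.ofReal_ne_top)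
  rw [← e]
  infer_instance

noncomputable def Phi (d : ℕ) (n Λ : ℝ)
    (G : EuclideanSpace ℝ (Fin d) → EuclideanSpace ℝ (Fin d) → ℝ)
    (zw : EuclideanSpace ℝ (Fin d) × EuclideanSpace ℝ (Fin d)) : ℝ≥0∞ :=
  ENNReal.ofReal (Λ * G zw.1 zw.2 / ‖zw.1 - zw.2‖ ^ n)

lemma measurable_Phi {d : ℕ} {n Λ : ℝ}
    {G : EuclideanSpace ℝ (Fin d) → EuclideanSpace ℝ (Fin d) → ℝ}
    (hG : Measurable (Function.uncurry G)) : Measurable (Phi d n Λ G) := by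
  unfold Phi
  have : Measurable fun zw : EuclideanSpace ℝ (Fin d) × EuclideanSpace ℝ (Fin d) => G zw.1 zw.2 := hG
  fun_prop

noncomputable def theta (d : ℕ) (n Λ : ℝ) (μ : Measure (EuclideanSpace ℝ (Fin d)))
    (G : EuclideanSpace ℝ (Fin d) → EuclideanSpace ℝ (Fin d) → ℝ) :
    Measure (EuclideanSpace ℝ (Fin d) × EuclideanSpace ℝ (Fin d)) :=
  μ.map (fun z => (z, z)) + volume.withDensity (Phi d n Λ G)

lemma lint_theta {d : ℕ} {n Λ : ℝ} {μ : Measure (EuclideanSpace ℝ (Fin d))}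
    {G : EuclideanSpace ℝ (Fin d) → EuclideanSpace ℝ (Fin d) → ℝ}
    (hG : Measurable (Function.uncurry G))
    {f : EuclideanSpace ℝ (Fin d) × EuclideanSpace ℝ (Fin d) → ℝ≥0∞} (hf : Measurable f) :
    ∫⁻ zw, f zw ∂(theta d n Λ μ G) = ∫⁻ z, f (z, z) ∂μ + ∫⁻ zw, Phi d n Λ G zw * f zw := by
  unfold theta
  rw [lintegral_add_measure, lintegral_map hf (by fun_prop),
    lintegral_withDensity_eq_lintegral_mul _ (measurable_Phi hG) hf]
  rfl

lemma theta_sfin {d : ℕ} {n Λ : ℝ} {μ : Measure (EuclideanSpace ℝ (Fin d))} [SFinite μ]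
    {G : EuclideanSpace ℝ (Fin d) → EuclideanSpace ℝ (Fin d) → ℝ} :
    SFinite (theta d n Λ μ G) := by
  unfold theta
  infer_instance

lemma theta_h3 {d : ℕ} {n Λ B : ℝ} (hn : 0 < n) (hΛ : 0 < Λ) {μ : Measure (EuclideanSpace ℝ (Fin d))}
    {G : EuclideanSpace ℝ (Fin d) → EuclideanSpace ℝ (Fin d) → ℝ}
    (hG : Measurable (Function.uncurry G)) (hG0 : ∀ z w, 0 ≤ G z w) (hGB : ∀ z w, G z w ≤ B)
    (f : EuclideanSpace ℝ (Fin d) × EuclideanSpace ℝ (Fin d) → ℝ≥0∞) (hf : Measurable f) :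
    ∫⁻ zw, ENNReal.ofReal (‖zw.1 - zw.2‖ ^ n) * f zw ∂(theta d n Λ μ G) ≤
      ENNReal.ofReal Λ * ENNReal.ofReal B * ∫⁻ zw, f zw := by
  have mm : Measurable fun zw : EuclideanSpace ℝ (Fin d) × EuclideanSpace ℝ (Fin d) =>
      ENNReal.ofReal (‖zw.1 - zw.2‖ ^ n) * f zw := by fun_prop
  rw [lint_theta hG mm]
  simp only [sub_self, norm_zero, Real.zero_rpow hn.ne', ENNReal.ofReal_zero, zero_mul,
    lintegral_zero, zero_add]
  rw [← lintegral_const_mul _ hf]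
  refine lintegral_mono fun zw => ?_
  rw [← mul_assoc]
  refine mul_le_mul' ?_ le_rfl
  unfold Phi
  have hB : 0 ≤ B := (hG0 0 0).trans (hGB 0 0)
  rw [← ENNReal.ofReal_mul hΛ.le, ← ENNReal.ofReal_mul (by have := hG0 zw.1 zw.2; positivity)]
  refine ENNReal.ofReal_le_ofReal ?_
  have h2 : Λ * G zw.1 zw.2 ≤ Λ * B := by gcongr; exact hGB _ _
  rcases eq_or_ne (‖zw.1 - zw.2‖ ^ n) 0 with h | h
  · rw [h, mul_zero]; positivity
  · rw [div_mul_cancel₀ _ h]; exact h2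

lemma Phi_le {d : ℕ} {α c Λ s : ℝ} (hΛ : 0 < Λ) (hs : 0 < s)
    {G : EuclideanSpace ℝ (Fin d) → EuclideanSpace ℝ (Fin d) → ℝ}
    (hG0 : ∀ z w, 0 ≤ G z w) (x z w : EuclideanSpace ℝ (Fin d)) (g : ℝ) (hg : 0 ≤ g)
    (hgle : g ≤ G z w + G w z) :
    ENNReal.ofReal (Λ * g / ‖z - w‖ ^ ((d : ℝ) + α)) * hE d (d + α) c s (x - z) ≤
      ENNReal.ofReal Λ * ENNReal.ofReal ((Gam d c s (x - z) + eta d α s (x - z)) *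
        (G z w + G w z) / ‖z - w‖ ^ ((d : ℝ) + α)) := by
  rw [hE_eq, ← ENNReal.ofReal_mul hΛ.le, ← ENNReal.ofReal_mul (by positivity)]
  refine ENNReal.ofReal_le_ofReal ?_
  have : 0 ≤ Gam d c s (x - z) + eta d α s (x - z) := by
    unfold Gam eta; positivity
  calc _ = Λ * ((Gam d c s (x - z) + eta d α s (x - z)) * g / ‖z - w‖ ^ ((d : ℝ) + α)) := by ring
    _ ≤ _ := by gcongr

lemma lint_sum {d : ℕ} {α c Λ T : ℝ} (hΛ : 0 < Λ) {μ : Measure (EuclideanSpace ℝ (Fin d))} [SFinite μ]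
    {G : EuclideanSpace ℝ (Fin d) → EuclideanSpace ℝ (Fin d) → ℝ} (x : EuclideanSpace ℝ (Fin d)) :
    ∫⁻ s in Ioc 0 T, (∫⁻ z, hE d (d + α) c s (x - z) ∂μ + ENNReal.ofReal Λ *
      ∫⁻ zw : EuclideanSpace ℝ (Fin d) × EuclideanSpace ℝ (Fin d),
      ENNReal.ofReal ((Gam d c s (x - zw.1) + eta d α s (x - zw.1)) *
        (G zw.1 zw.2 + G zw.2 zw.1) / ‖zw.1 - zw.2‖ ^ ((d : ℝ) + α))) ≤
      ENNReal.ofReal (1 + Λ) * (Nmu d α c μ T + NF d α c G T) := by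
  have m : Measurable fun s : ℝ => ∫⁻ z, hE d (d + α) c s (x - z) ∂μ :=
    Measurable.lintegral_prod_right' (f := fun b : ℝ × EuclideanSpace ℝ (Fin d) =>
      hE d (d + α) c b.1 (x - b.2)) ((measurable_hE d (d + α) c).comp
      (by fun_prop : Measurable fun b : ℝ × EuclideanSpace ℝ (Fin d) => (b.1, x - b.2)))
  rw [lintegral_add_left m, lintegral_const_mul' _ _ ENNReal.ofReal_ne_top,
    ENNReal.ofReal_add zero_le_one hΛ.le, ENNReal.ofReal_one, add_mul, one_mul]
  gcongr
  · refine le_trans ?_ le_self_add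
    simp only [hE_eq]
    exact le_iSup (fun x : EuclideanSpace ℝ (Fin d) => ∫⁻ s in Ioc (0 : ℝ) T, ∫⁻ y,
      ENNReal.ofReal (Gam d c s (x - y) + eta d α s (x - y)) ∂μ) x
  · refine le_trans ?_ le_add_self
    exact le_iSup (fun y : EuclideanSpace ℝ (Fin d) => ∫⁻ s in Set.Ioc (0 : ℝ) T,
      ∫⁻ zw : EuclideanSpace ℝ (Fin d) × EuclideanSpace ℝ (Fin d),
      ENNReal.ofReal ((Gam d c s (y - zw.1) + eta d α s (y - zw.1)) *
        (G zw.1 zw.2 + G zw.2 zw.1) / ‖zw.1 - zw.2‖ ^ ((d : ℝ) + α))) x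

lemma theta_h1 {d : ℕ} {α c Λ T : ℝ} (hΛ : 0 < Λ) {μ : Measure (EuclideanSpace ℝ (Fin d))} [SFinite μ]
    {G : EuclideanSpace ℝ (Fin d) → EuclideanSpace ℝ (Fin d) → ℝ}
    (hG : Measurable (Function.uncurry G)) (hG0 : ∀ z w, 0 ≤ G z w) (x : EuclideanSpace ℝ (Fin d)) :
    ∫⁻ s in Ioc 0 T, ∫⁻ zw, hE d (d + α) c s (x - zw.1) ∂(theta d (d + α) Λ μ G) ≤
      ENNReal.ofReal (1 + Λ) * (Nmu d α c μ T + NF d α c G T) := by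
  refine le_trans (setLIntegral_mono' measurableSet_Ioc fun s hs => ?_) (lint_sum hΛ x)
  have m : Measurable fun zw : EuclideanSpace ℝ (Fin d) × EuclideanSpace ℝ (Fin d) =>
      hE d (d + α) c s (x - zw.1) := (measurable_hE d (d + α) c).comp (by fun_prop : Measurable fun
    zw : EuclideanSpace ℝ (Fin d) × EuclideanSpace ℝ (Fin d) => (s, x - zw.1))
  rw [lint_theta hG m, ← lintegral_const_mul' _ _ ENNReal.ofReal_ne_top]
  refine add_le_add le_rfl (lintegral_mono fun zw => ?_)
  exact Phi_le hΛ hs.1 hG0 x zw.1 zw.2 (G zw.1 zw.2) (hG0 _ _) (by linarith [hG0 zw.2 zw.1])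

lemma theta_h2 {d : ℕ} {α c Λ T : ℝ} (hΛ : 0 < Λ) {μ : Measure (EuclideanSpace ℝ (Fin d))} [SFinite μ]
    {G : EuclideanSpace ℝ (Fin d) → EuclideanSpace ℝ (Fin d) → ℝ}
    (hG : Measurable (Function.uncurry G)) (hG0 : ∀ z w, 0 ≤ G z w) (y : EuclideanSpace ℝ (Fin d)) :
    ∫⁻ s in Ioc 0 T, ∫⁻ zw, hE d (d + α) c s (zw.2 - y) ∂(theta d (d + α) Λ μ G) ≤
      ENNReal.ofReal (1 + Λ) * (Nmu d α c μ T + NF d α c G T) := by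
  refine le_trans (setLIntegral_mono' measurableSet_Ioc fun s hs => ?_) (lint_sum hΛ y)
  have m : Measurable fun zw : EuclideanSpace ℝ (Fin d) × EuclideanSpace ℝ (Fin d) =>
      hE d (d + α) c s (zw.2 - y) := (measurable_hE d (d + α) c).comp (by fun_prop : Measurable fun
    zw : EuclideanSpace ℝ (Fin d) × EuclideanSpace ℝ (Fin d) => (s, zw.2 - y))
  rw [lint_theta hG m, ← lintegral_const_mul' _ _ ENNReal.ofReal_ne_top]
  refine add_le_add (lintegral_mono fun z => ?_) ?_
  · rw [hE_neg]
  · rw [Measure.volume_eq_prod, ← lintegral_prod_swap]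
    refine lintegral_mono fun zw => ?_
    have := Phi_le (α := α) (c := c) hΛ hs.1 hG0 y zw.1 zw.2 (G zw.2 zw.1) (hG0 _ _) (by linarith [hG0 zw.1 zw.2])
    simp only [Phi, Prod.fst_swap, Prod.snd_swap]
    rw [hE_neg, norm_sub_rev zw.2 zw.1]
    exact this

lemma q_le {d : ℕ} {α c Λ C T : ℝ} (hC : 1 ≤ C) (hT : T ≤ 1)
    {μ : Measure (EuclideanSpace ℝ (Fin d))} [SFinite μ]
    {G : EuclideanSpace ℝ (Fin d) → EuclideanSpace ℝ (Fin d) → ℝ}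
    (hG : Measurable (Function.uncurry G)) (hG0 : ∀ z w, 0 ≤ G z w)
    {p : ℝ → EuclideanSpace ℝ (Fin d) → EuclideanSpace ℝ (Fin d) → ℝ}
    (hp : ∀ t ∈ Set.Ioc (0 : ℝ) 1, ∀ x y,
          p t x y ≤ C * (Gam d (3 * c) t (x - y) + eta d α t (x - y)))
    {cc : EuclideanSpace ℝ (Fin d) → EuclideanSpace ℝ (Fin d) → ℝ}
    (hcc : ∀ z w, cc z w ∈ Set.Icc (0 : ℝ) Λ)
    {q : ℕ → ℝ → EuclideanSpace ℝ (Fin d) → EuclideanSpace ℝ (Fin d) → ℝ≥0∞}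
    (hq0 : ∀ t x y, q 0 t x y = ENNReal.ofReal (p t x y))
    (hq : ∀ k t x y, q (k + 1) t x y =
                (∫⁻ s in Set.Ioc (0 : ℝ) t, ∫⁻ z,
                    ENNReal.ofReal (p (t - s) x z) * q k s z y ∂μ) +
                ∫⁻ s in Set.Ioc (0 : ℝ) t,
                  ∫⁻ zw : EuclideanSpace ℝ (Fin d) × EuclideanSpace ℝ (Fin d),
                    ENNReal.ofReal (p (t - s) x zw.1) * q k s zw.2 y *
                      ENNReal.ofReal (cc zw.1 zw.2 * G zw.1 zw.2 /
                        ‖zw.1 - zw.2‖ ^ ((d : ℝ) + α)))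
    (y : EuclideanSpace ℝ (Fin d)) (k : ℕ) : ∀ t ∈ Ioc 0 T, ∀ x, q k t x y ≤
      QQ d (d + α) c T (ENNReal.ofReal C) (theta d (d + α) Λ μ G) y k t x := by
  have hpE : ∀ t ∈ Ioc (0:ℝ) T, ∀ x y, ENNReal.ofReal (p t x y) ≤
      ENNReal.ofReal C * PE d (d + α) (3 * c) t (x - y) := by
    intro t ht x y
    rw [hE_le_PE ht.1, hE_eq, ← ENNReal.ofReal_mul (by linarith)]
    exact ENNReal.ofReal_le_ofReal (hp t ⟨ht.1, ht.2.trans hT⟩ x y)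
  have : SFinite (theta d (d + α) Λ μ G) := theta_sfin
  induction k with
  | zero =>
    intro t ht x
    rw [hq0]
    simp only [QQ]
    exact hpE t ht x y
  | succ k ih =>
    intro t ht x
    rw [hq]
    simp only [QQ]
    set n := (d : ℝ) + α with hn
    set CE := ENNReal.ofReal C with hCE
    set QK := QQ d n c T CE (theta d n Λ μ G) y k with hQK
    have mQ : Measurable fun a : ℝ × EuclideanSpace ℝ (Fin d) => QK a.1 a.2 := measurable_QQ k
    have mF : Measurable fun ω : ℝ × EuclideanSpace ℝ (Fin d) × EuclideanSpace ℝ (Fin d) =>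
        CE * PE d n (3 * c) (t - ω.1) (x - ω.2.1) * QK ω.1 ω.2.2 :=
      (((measurable_PE d n (3 * c)).comp (by fun_prop : Measurable fun ω : ℝ × EuclideanSpace ℝ (Fin d) ×
        EuclideanSpace ℝ (Fin d) => (t - ω.1, x - ω.2.1))).const_mul _).mul
        (mQ.comp (by fun_prop : Measurable fun ω : ℝ × EuclideanSpace ℝ (Fin d) ×
        EuclideanSpace ℝ (Fin d) => (ω.1, ω.2.2)))
    rw [lintegral_prod _ mF.aemeasurable]
    have e1 : ∀ s, ∫⁻ zw, CE * PE d n (3 * c) (t - s) (x - zw.1) * QK s zw.2 ∂(theta d n Λ μ G) =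
        ∫⁻ z, CE * PE d n (3 * c) (t - s) (x - z) * QK s z ∂μ +
        ∫⁻ zw : EuclideanSpace ℝ (Fin d) × EuclideanSpace ℝ (Fin d),
          Phi d n Λ G zw * (CE * PE d n (3 * c) (t - s) (x - zw.1) * QK s zw.2) := fun s =>
      lint_theta hG (mF.comp (measurable_const.prodMk measurable_id : Measurable fun
            zw : EuclideanSpace ℝ (Fin d) × EuclideanSpace ℝ (Fin d) => (s, zw)))
    simp only [e1]
    have m1 : Measurable fun s : ℝ => ∫⁻ z, CE * PE d n (3 * c) (t - s) (x - z) * QK s z ∂μ :=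
      Measurable.lintegral_prod_right' (f := fun b : ℝ × EuclideanSpace ℝ (Fin d) =>
        CE * PE d n (3 * c) (t - b.1) (x - b.2) * QK b.1 b.2)
        (mF.comp (by fun_prop : Measurable fun b : ℝ × EuclideanSpace ℝ (Fin d) => (b.1, b.2, b.2)))
    rw [lintegral_add_left m1]
    have hsub : Ioo 0 t ⊆ Ioc 0 T := fun s hs => ⟨hs.1, hs.2.le.trans ht.2⟩
    refine add_le_add ?_ ?_
    · rw [← setLIntegral_congr Ioo_ae_eq_Ioc]
      refine le_trans (setLIntegral_mono' measurableSet_Ioo fun s hs => ?_)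
        (lintegral_mono_set hsub)
      refine lintegral_mono fun z => ?_
      exact mul_le_mul' (hpE (t - s) ⟨by linarith [hs.2], by linarith [hs.1, ht.2]⟩ x z)
        (ih s (hsub hs) z)
    · rw [← setLIntegral_congr Ioo_ae_eq_Ioc]
      refine le_trans (setLIntegral_mono' measurableSet_Ioo fun s hs => ?_)
        (lintegral_mono_set hsub)
      refine lintegral_mono fun zw => ?_
      rw [mul_comm]
      refine mul_le_mul' ?_ (mul_le_mul' (hpE (t - s) ⟨by linarith [hs.2], by linarith [hs.1, ht.2]⟩ x zw.1)
        (ih s (hsub hs) zw.2))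
      unfold Phi
      refine ENNReal.ofReal_le_ofReal ?_
      have := hG0 zw.1 zw.2
      have := (hcc zw.1 zw.2).2
      gcongr

/-- pointwise bound on the iterated perturbation kernels q⁽ᵏ⁾,
with `B` any uniform upper bound of `G` (in particular `B = ‖G‖_∞`).
For `k = 0` the second summand vanishes since `(k : ℝ≥0∞) = 0`. -/
theorem stmt18 (d : ℕ) (hd : 2 ≤ d) (α : ℝ) (hα1 : 0 < α) (hα2 : α < 2)
    (C lam Λ : ℝ) (hC : 1 ≤ C) (hlam : 0 < lam) (hΛ : 0 < Λ) :
    ∃ C' M : ℝ, 1 ≤ C' ∧ 1 ≤ M ∧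
      ∀ p : ℝ → EuclideanSpace ℝ (Fin d) → EuclideanSpace ℝ (Fin d) → ℝ,
        Measurable (fun q : ℝ × EuclideanSpace ℝ (Fin d) × EuclideanSpace ℝ (Fin d) =>
          p q.1 q.2.1 q.2.2) →
        (∀ t ∈ Set.Ioc (0 : ℝ) 1, ∀ x y, 0 ≤ p t x y) →
        (∀ t ∈ Set.Ioc (0 : ℝ) 1, ∀ x y,
          p t x y ≤ C * (Gam d lam t (x - y) + eta d α t (x - y))) →
        ∀ (μ : Measure (EuclideanSpace ℝ (Fin d)))
          (G : EuclideanSpace ℝ (Fin d) → EuclideanSpace ℝ (Fin d) → ℝ),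
          Measurable (Function.uncurry G) → (∀ z w, 0 ≤ G z w) →
          ∀ B : ℝ, (∀ z w, G z w ≤ B) →
          ∀ c : EuclideanSpace ℝ (Fin d) → EuclideanSpace ℝ (Fin d) → ℝ,
            Measurable (Function.uncurry c) → (∀ z w, c z w ∈ Set.Icc (0 : ℝ) Λ) →
            ∀ q : ℕ → ℝ → EuclideanSpace ℝ (Fin d) → EuclideanSpace ℝ (Fin d) → ℝ≥0∞,
              (∀ t x y, q 0 t x y = ENNReal.ofReal (p t x y)) →
              (∀ k t x y, q (k + 1) t x y =
                (∫⁻ s in Set.Ioc (0 : ℝ) t, ∫⁻ z,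
                    ENNReal.ofReal (p (t - s) x z) * q k s z y ∂μ) +
                ∫⁻ s in Set.Ioc (0 : ℝ) t,
                  ∫⁻ zw : EuclideanSpace ℝ (Fin d) × EuclideanSpace ℝ (Fin d),
                    ENNReal.ofReal (p (t - s) x zw.1) * q k s zw.2 y *
                      ENNReal.ofReal (c zw.1 zw.2 * G zw.1 zw.2 /
                        ‖zw.1 - zw.2‖ ^ ((d : ℝ) + α))) →
              ∀ (k : ℕ), ∀ t ∈ Set.Ioc (0 : ℝ) 1, ∀ x y : EuclideanSpace ℝ (Fin d),
                q k t x y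
                  ≤ ENNReal.ofReal C' * ENNReal.ofReal (pc d α (2 * lam / 3) t x y) *
                      ((ENNReal.ofReal M *
                          (Nmu d α (lam / 3) μ t + NF d α (lam / 3) G t)) ^ k
                        + (k : ℝ≥0∞) * ENNReal.ofReal B * ENNReal.ofReal M *
                          (ENNReal.ofReal M *
                            (Nmu d α (lam / 3) μ t + NF d α (lam / 3) G t)) ^ (k - 1)) := by
  obtain ⟨K, hK1, hK⟩ := pwE d hα1 hα2 (c := lam / 3) (by positivity)
  obtain ⟨c0, hc00, hc0⟩ := exc0 d hα1 hα2 (c := lam / 3) (by positivity)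
  set c' := lam / 3 with hc'
  have hc'p : 0 < c' := by positivity
  have h3c : lam = 3 * c' := by rw [hc']; ring
  have h2c : 2 * lam / 3 = 2 * c' := by rw [hc']; ring
  rw [h2c, h3c]
  set M := 4 * K * C * (1 + Λ) + 2 * K * Λ * C * c0 ^ 2 with hM
  have hM1 : 1 ≤ M := by
    have a1 : 1 ≤ K * C := one_le_mul_of_one_le_of_one_le hK1 hC
    have a2 : 0 ≤ 2 * K * Λ * C * c0 ^ 2 := by positivity
    have a3 : 0 ≤ K * C * Λ := by positivity
    nlinarith
  refine ⟨C, M, hC, hM1, ?_⟩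
  intro p _ _ hp μ G hG hG0 B hGB cc _ hcc q hq0 hq k t ht x y
  have hB : 0 ≤ B := (hG0 0 0).trans (hGB 0 0)
  have epc : ENNReal.ofReal (pc d α (2 * c') t x y) = hE d (d + α) (2 * c') t (x - y) := by
    rw [hE_eq]; rfl
  rw [epc]
  have hCpos : ENNReal.ofReal C ≠ 0 := by simp only [ne_eq, ENNReal.ofReal_eq_zero]; linarith
  have hMpos : ENNReal.ofReal M ≠ 0 := by simp only [ne_eq, ENNReal.ofReal_eq_zero]; linarith
  set N0 := Nmu d α c' μ t + NF d α c' G t with hN0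
  by_cases hN : N0 = ∞
  · rcases Nat.eq_zero_or_pos k with rfl | hk
    · rw [hq0]
      simp only [pow_zero, Nat.cast_zero, zero_mul, add_zero, mul_one]
      refine (ENNReal.ofReal_le_ofReal (hp t ht x y)).trans ?_
      rw [ENNReal.ofReal_mul (by linarith), ← hE_eq]
      gcongr
      exact hE_mono ht.1 (by linarith) _
    · have : ENNReal.ofReal C * hE d (d + α) (2 * c') t (x - y) ≠ 0 :=
        mul_ne_zero hCpos (hE_pos ht.1 _)
      rw [hN, ENNReal.mul_top hMpos, ENNReal.top_pow hk.ne', top_add, ENNReal.mul_top this]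
      exact le_top
  · have hNmu : Nmu d α c' μ t ≠ ∞ := fun h => hN (by rw [hN0, h, top_add])
    have : SFinite μ := sfin_of_N ht.1 μ hNmu
    have : SFinite (theta d (d + α) Λ μ G) := theta_sfin
    refine (q_le (c := c') (Λ := Λ) hC ht.2 hG hG0 hp hcc hq0 hq y k t ⟨ht.1, le_rfl⟩ x).trans ?_
    have hMeq : ENNReal.ofReal M = 4 * ENNReal.ofReal K * ENNReal.ofReal C * ENNReal.ofReal (1 + Λ) +
        2 * ENNReal.ofReal K * ENNReal.ofReal Λ * ENNReal.ofReal C * ENNReal.ofReal c0 ^ 2 := by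
      rw [hM, ENNReal.ofReal_add (by positivity) (by positivity), ENNReal.ofReal_mul (by positivity),
        ENNReal.ofReal_mul (by positivity), ENNReal.ofReal_mul (by positivity),
        ENNReal.ofReal_mul (by positivity), ENNReal.ofReal_mul (by positivity),
        ENNReal.ofReal_mul (by positivity), ENNReal.ofReal_mul (by positivity),
        ENNReal.ofReal_pow hc00]
      norm_num
    refine (core_ind (M := ENNReal.ofReal M) (N0 := N0) (B := ENNReal.ofReal B) hc'p ht.2 hK1 hK hc0
      (theta_h1 hΛ hG hG0) (theta_h2 hΛ hG hG0)
      (theta_h3 (by positivity) hΛ hG hG0 hGB) ENNReal.ofReal_ne_top ENNReal.ofReal_ne_top hN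
      ENNReal.ofReal_ne_top hMeq k t ⟨ht.1, le_rfl⟩ x).trans ?_
    rw [mul_add (ENNReal.ofReal C * hE d (d + α) (2 * c') t (x - y))]
    refine add_le_add (le_of_eq (mul_right_comm _ _ _)) ?_
    rw [mul_right_comm]
    gcongr
    exact eE_le_hE ht.1 _
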